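/- arXiv:math/0411457 — 2 statements merged into one kernel-verified Lean document; each statement's English description precedes it below -/
import Mathlib

section
/- Weighted Euler–Maclaurin with remainder for a simple integral orthant: Let v ∈ ℤ^n, let u_1,…,u_n ∈ ℤ^n be linearly independent primitive lattice vectors with dual basis α_1,…,α_n ∈ ℝ^n (⟨u_i,α_j⟩ = δ_{ij}), and let C = {x ∈ ℝ^n : ⟨u_i, x−v⟩ ≥ 0 for all i} = v + Σ_i ℝ_{≥0} α_i. Let Γ = ℤ^n/(ℤu_1+⋯+ℤu_n) (a finite group) and for γ ∈ Γ let λ_{γ,i} = e^{2πi⟨γ, α_i⟩} (well defined, a root of unity). Let q = (q_1,…,q_n) ∈ ℂ^n, let k > 1 be an integer, and let f : ℝ^n → ℂ be compactly supported of class C^{nk}. Then Σ_{x ∈ C ∩ ℤ^n} (Π_{i : ⟨u_i, x−v⟩ = 0} q_i) f(x) = Σ_{γ ∈ Γ} [Π_{i=1}^n N_{q_i}^{k,λ_{γ,i}}(∂/∂h_i)] ( ∫_{C(h)} f(x) dx ) |_{h=0} + R^C_{q,k}(f), where C(h) = {x ∈ ℝ^n : ⟨u_i, x−v⟩ + h_i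 ≥ 0 for all i} and R^C_{q,k}(f) = (1/|Γ|) Σ_{γ ∈ Γ} R^{st}_{q,k}(λ_{γ,1},…,λ_{γ,n}; f∘L) with L(t_1,…,t_n) = v + t_1 α_1 + ⋯ + t_n α_n. -/
open scoped BigOperators Classical
open MeasureTheory

/-- Coefficients of the Todd power series `Td(S) = S/(1-e^{-S}) = ∑ bernoulli' n · Sⁿ/n!`. -/
noncomputable def toddCoeff (j : ℕ) : ℂ := (bernoulli' j : ℂ) / j.factorial

/-- Coefficients of the Hirzebruch power series `χ_q(S) = q·Td(S) + (1-q)·Td(-S)`. -/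
noncomputable def chiCoeff (q : ℂ) (j : ℕ) : ℂ :=
  q * toddCoeff j + (1 - q) * (-1) ^ j * toddCoeff j

/-- `P_m(x) = B_m({x})/m!`. -/
noncomputable def periodicBernoulli (m : ℕ) (x : ℝ) : ℂ :=
  Polynomial.aeval ((Int.fract x : ℝ) : ℂ) (Polynomial.bernoulli m) / m.factorial

/-- The family `Q_{·,λ}`:  for `λ = 1` it is `Q_{m,1} = P_m = B_m({x})/m!`; for a root of
unity `λ ≠ 1` of order `N = orderOf λ`, `Q_{1,λ}(x) = λ^{⌊x⌋+1}/(1-λ)` and, for `m ≥ 2`,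
`Q_{m,λ}` is the unique continuous function with `Q_{m,λ}(x) = Q_{m,λ}(0) + ∫₀ˣ Q_{m-1,λ}`
and `∫₀ᴺ Q_{m,λ} = 0`. -/
def IsQFamily (lam : ℂ) (Q : ℕ → ℝ → ℂ) : Prop :=
  if lam = 1 then ∀ m x, Q m x = periodicBernoulli m x
  else (∀ x : ℝ, Q 1 x = lam ^ (⌊x⌋ + 1) / (1 - lam)) ∧
    ∀ m, 2 ≤ m → Continuous (Q m) ∧
      (∀ x : ℝ, Q m x = Q m 0 + ∫ t in (0 : ℝ)..x, Q (m - 1) t) ∧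
      (∫ t in (0 : ℝ)..((orderOf lam : ℕ) : ℝ), Q m t) = 0

/-- Coefficients of the polynomial `N_q^{k,λ}`:  for `λ ≠ 1`,
`N_q^{k,λ}(S) = (q + λ/(1-λ))S + ∑_{j=2}^k Q_{j,λ}(0)Sʲ`; for `λ = 1`,
`N_q^{k,1}(S) = χ_q^{2⌊k/2⌋}(S)`. -/
noncomputable def Ncoeff (q lam : ℂ) (Q : ℕ → ℝ → ℂ) (k : ℕ) : ℕ → ℂ := fun j =>
  if lam = 1 then (if j ≤ 2 * (k / 2) then chiCoeff q j else 0)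
  else (if j = 1 then q + lam / (1 - lam) else if 2 ≤ j ∧ j ≤ k then Q j 0 else 0)

/-- The partial derivative in the `i`-th coordinate direction. -/
noncomputable def coordPartial {n : ℕ} (i : Fin n)
    (H : (Fin n → ℝ) → ℂ) : (Fin n → ℝ) → ℂ :=
  fun x => fderiv ℝ H x (Pi.single i 1)

/-- The mixed partial derivative `∂^{j₁}_{h₁} ⋯ ∂^{jₙ}_{hₙ} H`. -/
noncomputable def mixedPartial {n : ℕ} (j : Fin n → ℕ)
    (H : (Fin n → ℝ) → ℂ) : (Fin n → ℝ) → ℂ :=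
  (List.finRange n).foldr (fun i G => (coordPartial i)^[j i] G) H

/-- `[∏ i, pᵢ(∂/∂hᵢ)] H |_{h=0}`, where `pᵢ` has coefficients `c i` and all the `pᵢ`
have degree `≤ k`. -/
noncomputable def opApply {n : ℕ} (c : Fin n → ℕ → ℂ) (k : ℕ)
    (H : (Fin n → ℝ) → ℂ) : ℂ :=
  ∑ j ∈ Fintype.piFinset (fun _ : Fin n => Finset.range (k + 1)),
    (∏ i, c i (j i)) * mixedPartial j H 0

/-- The dilated standard orthant `O(h) = {t : tᵢ ≥ -hᵢ for all i}`. -/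
def stdOrthant (n : ℕ) (h : Fin n → ℝ) : Set (Fin n → ℝ) := {t | ∀ i, -h i ≤ t i}

/-- The remainder `R^{st}_{q,k}(λ₁,…,λₙ; g)` for the standard orthant. -/
noncomputable def orthantRemainder {n : ℕ} (q lam : Fin n → ℂ)
    (Q : Fin n → ℕ → ℝ → ℂ) (k : ℕ) (g : (Fin n → ℝ) → ℂ) : ℂ :=
  ∑ I ∈ Finset.univ.powerset.erase (Finset.univ : Finset (Fin n)),
    (-1 : ℂ) ^ ((k - 1) * (n - I.card)) *
      opApply
        (fun i => if i ∈ I then Ncoeff (q i) (lam i) (Q i) k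
          else fun j => if j = 0 then 1 else 0) k
        (fun h => ∫ t in stdOrthant n h,
          (∏ i ∈ Iᶜ, Q i k (t i)) *
            mixedPartial (fun i => if i ∈ I then 0 else k) g t)

/-- The root of unity `λ_{γ,i} = e^{2πi⟨g,αᵢ⟩}` attached to a representative `g` of a
class in `Γ` and the `i`-th edge vector `αᵢ`. -/
noncomputable def lamOf {n : ℕ} (α : Fin n → Fin n → ℝ) (g : Fin n → ℤ) (i : Fin n) : ℂ :=
  Complex.exp (2 * Real.pi * Complex.I * (∑ j, (g j : ℝ) * α i j))

/-- The properties of a family `Q` of kernels that drive the one-dimensional twisted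
Euler–Maclaurin formula: `Q 1` is affine of slope `b` between consecutive integers, with jump
`-lam ^ m` at the integer `m`, and each later `Q (j + 1)` is a primitive of `Q j`. -/
structure IsSummationKernel (lam : ℂ) (Q : ℕ → ℝ → ℂ) (a : ℕ → ℂ) (b : ℂ) : Prop where
  affine : ∀ (m : ℕ), ∀ t ∈ Set.Ioo (m : ℝ) (m + 1), Q 1 t = a m + b * (t - m)
  jump : ∀ m, a m + b = a (m + 1) + lam ^ (m + 1)
  continuous : ∀ j, Continuous (Q (j + 2))
  hasDerivWithinAt : ∀ j x, HasDerivWithinAt (Q (j + 2)) (Q (j + 1) x) (Set.Ioi x) x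

theorem ae_mem_uIoc_imp_of_Ioo {m : ℝ} {f g : ℝ → ℂ}
    (h : ∀ t ∈ Set.Ioo m (m + 1), f t = g t) :
    ∀ᵐ t ∂(volume : Measure ℝ), t ∈ Set.uIoc m (m + 1) → f t = g t := by
  have : ∀ᵐ t ∂(volume : Measure ℝ), t ≠ m + 1 := by
    simp [ae_iff]
  filter_upwards [this] with t ht hmem
  rw [Set.uIoc_of_le (by linarith)] at hmem
  exact h t ⟨hmem.1, lt_of_le_of_ne hmem.2 ht⟩

namespace IsSummationKernel

variable {lam : ℂ} {Q : ℕ → ℝ → ℂ} {a : ℕ → ℂ} {b : ℂ}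

theorem intervalIntegrable_one (hQ : IsSummationKernel lam Q a b) (M : ℕ) :
    IntervalIntegrable (Q 1) volume 0 M := by
  have key : ∀ m < M, IntervalIntegrable (Q 1) volume ((fun i : ℕ => (i : ℝ)) m)
      ((fun i : ℕ => (i : ℝ)) (m + 1)) := by
    intro m _
    have h1 : IntervalIntegrable (fun t : ℝ => a m + b * ((t : ℂ) - m)) volume m (m + 1) :=
      Continuous.intervalIntegrable (by fun_prop) _ _
    have := h1.congr_ae (g := Q 1) ?_
    · simpa using this
    · rw [Filter.EventuallyEq, ae_restrict_iff' measurableSet_uIoc]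
      filter_upwards [ae_mem_uIoc_imp_of_Ioo (hQ.affine m)] with t ht hm
      exact (ht hm).symm
  simpa using IntervalIntegrable.trans_iterate key

theorem intervalIntegrable (hQ : IsSummationKernel lam Q a b) (M j : ℕ) :
    IntervalIntegrable (Q (j + 1)) volume 0 M := by
  cases j with
  | zero => exact hQ.intervalIntegrable_one M
  | succ j => exact (hQ.continuous j).intervalIntegrable _ _

theorem integral_one_mul_deriv (hQ : IsSummationKernel lam Q a b) {F : ℝ → ℂ}
    (hF : ContDiff ℝ 1 F) (M : ℕ) :
    ∫ t in (0 : ℝ)..M, Q 1 t * deriv F t =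
      ∑ m ∈ Finset.range M, lam ^ (m + 1) * F ((m + 1 : ℕ) : ℝ) + a M * F M - a 0 * F 0
        - b * ∫ t in (0 : ℝ)..M, F t := by
  have hcF := hF.continuous
  have hdF : Continuous (deriv F) := hF.continuous_deriv le_rfl
  induction M with
  | zero => simp
  | succ M ih =>
    have hi : IntervalIntegrable (fun t => Q 1 t * deriv F t) volume 0 ((M + 1 : ℕ) : ℝ) :=
      (hQ.intervalIntegrable_one _).mul_continuousOn hdF.continuousOn
    have hi' : IntervalIntegrable (fun t => Q 1 t * deriv F t) volume 0 (M : ℝ) :=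
      (hQ.intervalIntegrable_one _).mul_continuousOn hdF.continuousOn
    have step : ∫ t in (M : ℝ)..((M + 1 : ℕ) : ℝ), Q 1 t * deriv F t =
        (a M + b) * F ((M + 1 : ℕ) : ℝ) - a M * F M
          - b * ∫ t in (M : ℝ)..((M + 1 : ℕ) : ℝ), F t := by
      push_cast
      rw [intervalIntegral.integral_congr_ae (g := fun t => (a M + b * ((t : ℂ) - M)) * deriv F t)]
      · rw [intervalIntegral.integral_mul_deriv_eq_deriv_mul (u' := fun _ => b) (v := F)]
        · simp
        · intro x _
          have h1 : HasDerivAt (fun t : ℝ => (t : ℂ)) 1 x := Complex.ofRealCLM.hasDerivAt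
          simpa using ((h1.sub_const (M : ℂ)).const_mul b).const_add (a M)
        · intro x _
          exact (hF.differentiable one_ne_zero x).hasDerivAt
        · exact intervalIntegrable_const
        · exact hdF.intervalIntegrable _ _
      · exact ae_mem_uIoc_imp_of_Ioo fun t ht => by rw [hQ.affine M t ht]
    rw [← intervalIntegral.integral_add_adjacent_intervals hi' (hi'.symm.trans hi), ih, step,
      ← intervalIntegral.integral_add_adjacent_intervals (hcF.intervalIntegrable 0 M)
        (hcF.intervalIntegrable M ((M + 1 : ℕ) : ℝ)), Finset.sum_range_succ, hQ.jump M]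
    ring

theorem integral_mul_iterate_deriv_succ (hQ : IsSummationKernel lam Q a b) {F : ℝ → ℂ} {j : ℕ}
    (hF : ContDiff ℝ (j + 2 : ℕ) F) (M : ℕ) (hM : deriv^[j + 1] F M = 0) :
    ∫ t in (0 : ℝ)..M, Q (j + 1) t * deriv^[j + 1] F t =
      -(Q (j + 2) 0 * deriv^[j + 1] F 0) - ∫ t in (0 : ℝ)..M, Q (j + 2) t * deriv^[j + 2] F t := by
  have h1 : ContDiff ℝ 1 (deriv^[j + 1] F) := by
    have := ContDiff.iterate_deriv' 1 (j + 1) (f := F) (𝕜 := ℝ) (by rwa [show 1 + (j + 1) = j + 2 by ring])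
    simpa using this
  have h2 : deriv^[j + 2] F = deriv (deriv^[j + 1] F) := Function.iterate_succ_apply' _ _ _
  rw [h2, intervalIntegral.integral_mul_deriv_eq_deriv_mul_of_hasDeriv_right
    (u := Q (j + 2)) (v := deriv^[j + 1] F) (u' := Q (j + 1)), hM]
  · ring
  · exact (hQ.continuous j).continuousOn
  · exact h1.continuous.continuousOn
  · intro x _; exact hQ.hasDerivWithinAt j x
  · intro x _; exact (h1.differentiable one_ne_zero x).hasDerivAt.hasDerivWithinAt
  · exact hQ.intervalIntegrable M j
  · exact (h1.continuous_deriv le_rfl).intervalIntegrable _ _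

theorem euler_maclaurin (hQ : IsSummationKernel lam Q a b) (q : ℂ) {F : ℝ → ℂ} (M k : ℕ)
    (hF : ContDiff ℝ (k + 1 : ℕ) F) (hM : ∀ j ≤ k, deriv^[j] F M = 0) :
    ∑ m ∈ Finset.range (M + 1), (if m = 0 then q else lam ^ m) * F m =
      b * (∫ t in (0 : ℝ)..M, F t) + (q + a 0) * F 0
        + ∑ j ∈ Finset.range k, (-1) ^ (j + 1) * Q (j + 2) 0 * deriv^[j + 1] F 0
        + (-1) ^ k * ∫ t in (0 : ℝ)..M, Q (k + 1) t * deriv^[k + 1] F t := by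
  induction k with
  | zero =>
    have := hQ.integral_one_mul_deriv (F := F) (by simpa using hF) M
    have h0 : F M = 0 := by simpa using hM 0 le_rfl
    rw [Finset.sum_range_succ']
    simp only [Nat.succ_ne_zero, if_false, Finset.range_zero, Finset.sum_empty, pow_zero,
      zero_add, Function.iterate_one, this, h0]
    simp
    ring
  | succ k ih =>
    rw [ih (hF.of_le (by norm_cast; omega)) (fun j hj => hM j (by omega)),
      hQ.integral_mul_iterate_deriv_succ hF M (hM _ le_rfl), Finset.sum_range_succ]
    ring

end IsSummationKernel

theorem eventually_floor_eq_nhdsWithin_Ici (x : ℝ) :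
    ∀ᶠ t : ℝ in nhdsWithin x (Set.Ici x), ⌊t⌋ = ⌊x⌋ := by
  have : ∀ᶠ t : ℝ in nhdsWithin x (Set.Ici x), t < ⌊x⌋ + 1 :=
    nhdsWithin_le_nhds (Iio_mem_nhds (Int.lt_floor_add_one x))
  filter_upwards [this, self_mem_nhdsWithin] with t ht hx
  exact Int.floor_eq_iff.2 ⟨(Int.floor_le x).trans hx, ht⟩

theorem isSummationKernel_of_ne_one {lam : ℂ} (h1 : lam ≠ 1) (hn : ‖lam‖ = 1) {Q : ℕ → ℝ → ℂ}
    (hQ : IsQFamily lam Q) :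
    IsSummationKernel lam Q (fun m => lam ^ (m + 1) / (1 - lam)) 0 := by
  rw [IsQFamily, if_neg h1] at hQ
  obtain ⟨hQ1, hQm⟩ := hQ
  have hsub : 1 - lam ≠ 0 := sub_ne_zero.2 (Ne.symm h1)
  refine ⟨?_, ?_, fun j => (hQm (j + 2) (by omega)).1, ?_⟩
  · intro m t ht
    have hfl : ⌊t⌋ = m := Int.floor_eq_iff.2 ⟨by exact_mod_cast ht.1.le, by exact_mod_cast ht.2⟩
    rw [hQ1, hfl]
    norm_cast
    simp
  · intro m
    field_simp
    ring
  · have hmeas : Measurable (Q 1) := by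
      rw [funext hQ1]
      exact (measurable_from_top (f := fun z : ℤ => lam ^ (z + 1) / (1 - lam))).comp
        Int.measurable_floor
    have hbound : ∀ x, ‖Q 1 x‖ ≤ 1 / ‖1 - lam‖ := by
      intro x
      simp [hQ1, hn]
    have hmeasj : ∀ j, Measurable (Q (j + 1)) := by
      intro j
      cases j with
      | zero => exact hmeas
      | succ j => exact (hQm (j + 2) (by omega)).1.measurable
    have hcont : ∀ j x, ContinuousWithinAt (Q (j + 1)) (Set.Ici x) x := by
      intro j x
      cases j with
      | zero =>
        refine (continuousWithinAt_const (b := Q 1 x)).congr_of_eventuallyEq ?_ rfl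
        filter_upwards [eventually_floor_eq_nhdsWithin_Ici x] with t ht
        rw [zero_add, hQ1, hQ1, ht]
      | succ j => exact (hQm (j + 2) (by omega)).1.continuousWithinAt
    have hint : ∀ j (x : ℝ), IntervalIntegrable (Q (j + 1)) volume 0 x := by
      intro j x
      cases j with
      | zero =>
        refine (intervalIntegrable_const (c := (1 / ‖1 - lam‖ : ℝ))).mono_fun
          hmeas.aestronglyMeasurable (Filter.Eventually.of_forall fun t => ?_)
        exact (hbound t).trans (le_abs_self _)
      | succ j => exact (hQm (j + 2) (by omega)).1.intervalIntegrable _ _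
    intro j x
    rw [funext (hQm (j + 2) (by omega)).2.1]
    have := intervalIntegral.integral_hasDerivWithinAt_right (s := Set.Ici x) (t := Set.Ioi x)
      (hint j x) ((hmeasj j).stronglyMeasurable.stronglyMeasurableAtFilter)
      ((hcont j x).mono Set.Ioi_subset_Ici_self)
    exact (this.mono Set.Ioi_subset_Ici_self).const_add _

theorem periodicBernoulli_eq_bernoulliFun (m : ℕ) (x : ℝ) :
    periodicBernoulli m x = ((bernoulliFun m (Int.fract x) / m.factorial : ℝ) : ℂ) := by
  have : ((bernoulliFun m (Int.fract x) : ℝ) : ℂ) =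
      Polynomial.aeval ((Int.fract x : ℝ) : ℂ) (Polynomial.bernoulli m) := by
    rw [bernoulliFun, Polynomial.eval_map_algebraMap]
    exact (Polynomial.aeval_algebraMap_apply ℂ (Int.fract x) (Polynomial.bernoulli m)).symm
  rw [periodicBernoulli, ← this]
  push_cast
  rfl

theorem continuous_bernoulliFun_fract {m : ℕ} (hm : m ≠ 1) :
    Continuous fun x : ℝ => bernoulliFun m (Int.fract x) := by
  have h := (periodizedBernoulli.continuous hm).comp (AddCircle.continuous_mk' (1 : ℝ))
  convert h using 1
  ext x
  have hx : ((x : ℝ) : UnitAddCircle) = ((Int.fract x : ℝ) : UnitAddCircle) := by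
    rw [← sub_eq_zero, ← AddCircle.coe_sub, Int.self_sub_fract]
    exact (AddCircle.coe_eq_zero_iff (1 : ℝ)).2 ⟨⌊x⌋, by simp⟩
  change _ = periodizedBernoulli m (x : UnitAddCircle)
  rw [hx, periodizedBernoulli, AddCircle.liftIco_coe_apply]
  rw [zero_add]
  exact ⟨Int.fract_nonneg x, Int.fract_lt_one x⟩

theorem isSummationKernel_one {Q : ℕ → ℝ → ℂ} (hQ : IsQFamily 1 Q) :
    IsSummationKernel 1 Q (fun _ => -(1 / 2)) 1 := by
  rw [IsQFamily, if_pos rfl] at hQ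
  have hQ' : ∀ m x, Q m x = ((bernoulliFun m (Int.fract x) / m.factorial : ℝ) : ℂ) :=
    fun m x => (hQ m x).trans (periodicBernoulli_eq_bernoulliFun m x)
  refine ⟨?_, ?_, ?_, ?_⟩
  · intro m t ht
    have hfl : ⌊t⌋ = m := Int.floor_eq_iff.2 ⟨by exact_mod_cast ht.1.le, by exact_mod_cast ht.2⟩
    rw [hQ', Int.fract, hfl]
    simp
    ring
  · intro m
    norm_num
  · intro j
    rw [funext (hQ' (j + 2))]
    have := continuous_bernoulliFun_fract (m := j + 2) (by omega)
    fun_prop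
  · intro j x
    rw [funext (hQ' (j + 2)), hQ']
    have hd : HasDerivAt (fun t : ℝ => bernoulliFun (j + 2) (t - ⌊x⌋) / ((j + 2).factorial : ℝ))
        (bernoulliFun (j + 1) (Int.fract x) / ((j + 1).factorial : ℝ)) x := by
      have h1 := (hasDerivAt_bernoulliFun (j + 2) (x - ⌊x⌋)).comp x
        ((hasDerivAt_id x).sub_const (⌊x⌋ : ℝ))
      have h2 := h1.div_const ((j + 2).factorial : ℝ)
      refine h2.congr_deriv ?_
      rw [Nat.factorial_succ (j + 1), Int.fract]
      have : ((j + 1).factorial : ℝ) ≠ 0 := by positivity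
      simp only [show j + 2 - 1 = j + 1 by omega]
      push_cast
      field_simp
      ring
    refine hd.ofReal_comp.hasDerivWithinAt.congr_of_eventuallyEq ?_ rfl
    filter_upwards [nhdsWithin_mono x Set.Ioi_subset_Ici_self (eventually_floor_eq_nhdsWithin_Ici x)]
      with t ht
    rw [Int.fract, ht]

theorem toddCoeff_eq_periodicBernoulli {j : ℕ} (hj : j ≠ 1) :
    toddCoeff j = periodicBernoulli j 0 := by
  rw [periodicBernoulli_eq_bernoulliFun, toddCoeff, Int.fract_zero, bernoulliFun_eval_zero,
    bernoulli_eq_bernoulli'_of_ne_one hj]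
  push_cast
  rfl

theorem toddCoeff_eq_zero_of_odd {j : ℕ} (hj : Odd j) (hj1 : 1 < j) : toddCoeff j = 0 := by
  simp [toddCoeff, bernoulli'_eq_zero_of_odd hj hj1]

theorem chiCoeff_eq_periodicBernoulli (q : ℂ) {j : ℕ} (hj : 2 ≤ j) :
    chiCoeff q j = periodicBernoulli j 0 := by
  rw [chiCoeff, ← toddCoeff_eq_periodicBernoulli (by omega)]
  rcases Nat.even_or_odd j with h | h
  · rw [h.neg_one_pow]; ring
  · rw [toddCoeff_eq_zero_of_odd h (by omega)]; ring

/-- The kernels attached to `lam` and their relation to the coefficients of `N_q^{k,lam}`. -/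
theorem IsQFamily.exists_isSummationKernel {lam : ℂ} (hn : ‖lam‖ = 1) {Q : ℕ → ℝ → ℂ}
    (hQ : IsQFamily lam Q) (q : ℂ) {k : ℕ} (hk : 1 < k) :
    ∃ a b, IsSummationKernel lam Q a b ∧ Ncoeff q lam Q k 0 = b ∧ Ncoeff q lam Q k 1 = q + a 0 ∧
      ∀ j, 2 ≤ j → j ≤ k → Ncoeff q lam Q k j = Q j 0 := by
  by_cases h1 : lam = 1
  · subst h1
    refine ⟨_, _, isSummationKernel_one hQ, ?_, ?_, ?_⟩
    · simp [Ncoeff, chiCoeff, toddCoeff]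
    · have : 1 ≤ 2 * (k / 2) := by omega
      simp [Ncoeff, this, chiCoeff, toddCoeff]
      ring
    · intro j h2 hjk
      rw [IsQFamily, if_pos rfl] at hQ
      rw [Ncoeff, if_pos rfl, hQ]
      split_ifs with h
      · exact chiCoeff_eq_periodicBernoulli q h2
      · rw [← toddCoeff_eq_periodicBernoulli (by omega), toddCoeff_eq_zero_of_odd _ (by omega)]
        rcases Nat.even_or_odd j with he | ho
        · obtain ⟨r, rfl⟩ := he
          omega
        · exact ho
  · refine ⟨_, _, isSummationKernel_of_ne_one h1 hn hQ, ?_, ?_, ?_⟩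
    · simp [Ncoeff, h1]
    · simp [Ncoeff, h1]
    · intro j h2 hjk
      simp [Ncoeff, h1, h2, hjk, show j ≠ 1 by omega]

/-- The terms of the one-dimensional Euler–Maclaurin formula: `(true, j)` is the weight of the
`j`-th derivative in the main part, `(false, 0)` that of the `k`-th derivative in the remainder. -/
noncomputable def emWeight (q lam : ℂ) (Q : ℕ → ℝ → ℂ) (k : ℕ) (s : Bool × Fin (k + 1))
    (t : ℝ) : ℂ :=
  if s.1 then (-1) ^ (s.2 : ℕ) * Ncoeff q lam Q k s.2
  else if (s.2 : ℕ) = 0 then (-1) ^ (k - 1) * Q k t else 0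

/-- The order of differentiation that goes with `emWeight`. -/
def emOrder (k : ℕ) (s : Bool × Fin (k + 1)) : ℕ := if s.1 then s.2 else k

theorem emOrder_le (k : ℕ) (s : Bool × Fin (k + 1)) : emOrder k s ≤ k := by
  rw [emOrder]
  split_ifs
  · exact Nat.lt_succ_iff.1 s.2.2
  · exact le_rfl

theorem iterate_deriv_eq_zero_of_forall_lt {F : ℝ → ℂ} {B : ℝ} (hF : ∀ t, B < t → F t = 0)
    (j : ℕ) : ∀ t, B < t → deriv^[j] F t = 0 := by
  induction j with
  | zero => simpa using hF
  | succ j ih =>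
    intro t ht
    rw [Function.iterate_succ_apply']
    have : deriv^[j] F =ᶠ[nhds t] fun _ => 0 := by
      filter_upwards [Ioi_mem_nhds ht] with s hs using ih s hs
    rw [this.deriv_eq, deriv_const]

theorem setIntegral_Ici_zero_eq_intervalIntegral {G : ℝ → ℂ} {M : ℝ} (hM : 0 ≤ M)
    (h : ∀ t, M < t → G t = 0) : ∫ t in Set.Ici (0 : ℝ), G t = ∫ t in (0 : ℝ)..M, G t := by
  rw [integral_Ici_eq_integral_Ioi, intervalIntegral.integral_of_le hM]
  refine setIntegral_eq_of_subset_of_forall_sdiff_eq_zero measurableSet_Ioi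
    Set.Ioc_subset_Ioi_self fun t ht => h t ?_
  by_contra hc
  exact ht.2 ⟨ht.1, not_lt.1 hc⟩

theorem sum_twisted_eq_sum_integral {lam : ℂ} (hn : ‖lam‖ = 1) {Q : ℕ → ℝ → ℂ}
    (hQ : IsQFamily lam Q) (q : ℂ) {k : ℕ} (hk : 1 < k) {F : ℝ → ℂ} (hF : ContDiff ℝ (k : ℕ) F)
    {B : ℝ} {M : ℕ} (hB : B < M) (hFB : ∀ t, B < t → F t = 0) :
    ∑ m ∈ Finset.range (M + 1), (if m = 0 then q else lam ^ m) * F m =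
      ∑ s : Bool × Fin (k + 1),
        ∫ t in Set.Ici (0 : ℝ), emWeight q lam Q k s t * deriv^[emOrder k s] F t := by
  obtain ⟨a, b, hK, h0, h1, h2⟩ := hQ.exists_isSummationKernel hn q hk
  obtain ⟨k, rfl⟩ : ∃ k', k = k' + 1 := ⟨k - 1, by omega⟩
  have hz := iterate_deriv_eq_zero_of_forall_lt hFB
  have hzM : ∀ j, deriv^[j] F M = 0 := fun j => hz j M hB
  have hdiff : ∀ j ≤ k, ContDiff ℝ 1 (deriv^[j] F) := fun j hj => by
    have := ContDiff.iterate_deriv' 1 j (f := F) (𝕜 := ℝ) (hF.of_le (by norm_cast; omega))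
    simpa using this
  have hftc : ∀ j ≤ k, ∫ t in (0 : ℝ)..M, deriv^[j + 1] F t = - deriv^[j] F 0 := by
    intro j hj
    have hd := hdiff j hj
    rw [Function.iterate_succ', Function.comp_def]
    rw [intervalIntegral.integral_deriv_eq_sub
      (fun x _ => hd.differentiable one_ne_zero x)
      ((hd.continuous_deriv le_rfl).intervalIntegrable _ _), hzM]
    ring
  have hI : ∀ s : Bool × Fin (k + 1 + 1),
      ∫ t in Set.Ici (0 : ℝ), emWeight q lam Q (k + 1) s t * deriv^[emOrder (k + 1) s] F t =
      ∫ t in (0 : ℝ)..M, emWeight q lam Q (k + 1) s t * deriv^[emOrder (k + 1) s] F t :=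
    fun s => setIntegral_Ici_zero_eq_intervalIntegral M.cast_nonneg
      fun t ht => by rw [hz _ t (hB.trans ht), mul_zero]
  rw [hK.euler_maclaurin q M k hF (fun j _ => hzM j), Finset.sum_congr rfl fun s _ => hI s,
    Fintype.sum_prod_type, Fintype.sum_bool]
  congr 1
  · have key : ∑ x : Fin (k + 1 + 1), (∫ t in (0 : ℝ)..M,
          emWeight q lam Q (k + 1) (true, x) t * deriv^[emOrder (k + 1) (true, x)] F t) =
        ∑ j ∈ Finset.range (k + 1 + 1), (-1) ^ j * Ncoeff q lam Q (k + 1) j *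
          ∫ t in (0 : ℝ)..M, deriv^[j] F t := by
      rw [← Fin.sum_univ_eq_sum_range (fun j => (-1) ^ j * Ncoeff q lam Q (k + 1) j *
          ∫ t in (0 : ℝ)..M, deriv^[j] F t)]
      refine Finset.sum_congr rfl fun x _ => ?_
      simp [emWeight, emOrder]
    rw [key, Finset.sum_range_succ', Finset.sum_range_succ', hftc 0 (by omega), h0, h1]
    have : ∀ j ∈ Finset.range k, (-1) ^ (j + 1 + 1) * Ncoeff q lam Q (k + 1) (j + 1 + 1) *
          ∫ t in (0 : ℝ)..M, deriv^[j + 1 + 1] F t =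
        (-1) ^ (j + 1) * Q (j + 2) 0 * deriv^[j + 1] F 0 := by
      intro j hj
      rw [Finset.mem_range] at hj
      rw [hftc (j + 1) (by omega), h2 (j + 1 + 1) (by omega) (by omega)]
      ring
    rw [Finset.sum_congr rfl this]
    simp
    ring
  · rw [Finset.sum_eq_single (0 : Fin (k + 1 + 1))]
    · simp [emWeight, emOrder, mul_assoc]
    · intro x _ hx
      have : (x : ℕ) ≠ 0 := fun h => hx (Fin.ext h)
      simp [emWeight, hx]
    · simp

section Partial

variable {n : ℕ}

/-- The composition of the operators `∂ᵢ ^ (j i)` for `i` running through the list `l`. -/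
noncomputable def listPartial (l : List (Fin n)) (j : Fin n → ℕ) (H : (Fin n → ℝ) → ℂ) :
    (Fin n → ℝ) → ℂ :=
  l.foldr (fun i G => (coordPartial i)^[j i] G) H

theorem mixedPartial_eq_listPartial (j : Fin n → ℕ) (H : (Fin n → ℝ) → ℂ) :
    mixedPartial j H = listPartial (List.finRange n) j H := rfl

theorem listPartial_cons (i : Fin n) (l : List (Fin n)) (j : Fin n → ℕ)
    (H : (Fin n → ℝ) → ℂ) :
    listPartial (i :: l) j H = (coordPartial i)^[j i] (listPartial l j H) := rfl

theorem sum_map_finRange (j : Fin n → ℕ) : ((List.finRange n).map j).sum = ∑ i, j i :=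
  (Fin.sum_univ_def j).symm

theorem contDiff_coordPartial (i : Fin n) {r : ℕ} {H : (Fin n → ℝ) → ℂ}
    (hH : ContDiff ℝ (r + 1 : ℕ) H) : ContDiff ℝ (r : ℕ) (coordPartial i H) :=
  (hH.fderiv_right (m := (r : ℕ)) (by norm_cast)).clm_apply contDiff_const

theorem contDiff_iterate_coordPartial (i : Fin n) {r : ℕ} (a : ℕ) {H : (Fin n → ℝ) → ℂ}
    (hH : ContDiff ℝ (r + a : ℕ) H) : ContDiff ℝ (r : ℕ) ((coordPartial i)^[a] H) := by
  induction a generalizing H with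
  | zero => simpa using hH
  | succ a ih =>
    rw [Function.iterate_succ_apply]
    exact ih (contDiff_coordPartial i (by rwa [← add_assoc] at hH))

theorem contDiff_listPartial (l : List (Fin n)) (j : Fin n → ℕ) {r : ℕ} {H : (Fin n → ℝ) → ℂ}
    (hH : ContDiff ℝ (r + (l.map j).sum : ℕ) H) : ContDiff ℝ (r : ℕ) (listPartial l j H) := by
  induction l generalizing r with
  | nil => exact hH
  | cons i l ih =>
    rw [listPartial_cons]
    refine contDiff_iterate_coordPartial i _ (ih ?_)
    rwa [List.map_cons, List.sum_cons, ← add_assoc] at hH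

theorem contDiff_mixedPartial (j : Fin n → ℕ) {r : ℕ} {H : (Fin n → ℝ) → ℂ}
    (hH : ContDiff ℝ (r + ∑ i, j i : ℕ) H) : ContDiff ℝ (r : ℕ) (mixedPartial j H) :=
  contDiff_listPartial _ j (by rwa [sum_map_finRange])

theorem hasCompactSupport_coordPartial (i : Fin n) {H : (Fin n → ℝ) → ℂ}
    (hH : HasCompactSupport H) : HasCompactSupport (coordPartial i H) :=
  hH.fderiv_apply ℝ _

theorem hasCompactSupport_listPartial (l : List (Fin n)) (j : Fin n → ℕ)
    {H : (Fin n → ℝ) → ℂ} (hH : HasCompactSupport H) : HasCompactSupport (listPartial l j H) := by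
  induction l with
  | nil => exact hH
  | cons i l ih =>
    rw [listPartial_cons]
    generalize j i = a
    induction a with
    | zero => exact ih
    | succ a iha =>
      rw [Function.iterate_succ_apply']
      exact hasCompactSupport_coordPartial i iha

theorem hasCompactSupport_mixedPartial (j : Fin n → ℕ) {H : (Fin n → ℝ) → ℂ}
    (hH : HasCompactSupport H) : HasCompactSupport (mixedPartial j H) :=
  hasCompactSupport_listPartial _ j hH

theorem coordPartial_comm (i i' : Fin n) {H : (Fin n → ℝ) → ℂ} (hH : ContDiff ℝ 2 H) :
    coordPartial i (coordPartial i' H) = coordPartial i' (coordPartial i H) := by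
  ext x
  have hd : DifferentiableAt ℝ (fderiv ℝ H) x :=
    (hH.fderiv_right (m := 1) le_rfl).differentiable one_ne_zero x
  have hs : IsSymmSndFDerivAt ℝ H x := hH.contDiffAt.isSymmSndFDerivAt (by simp)
  have key : ∀ a b : Fin n, coordPartial a (coordPartial b H) x =
      fderiv ℝ (fderiv ℝ H) x (Pi.single a 1) (Pi.single b 1) := by
    intro a b
    change fderiv ℝ (fun y => fderiv ℝ H y (Pi.single b 1)) x (Pi.single a 1) = _
    rw [fderiv_clm_apply hd (differentiableAt_const _)]
    simp
  rw [key, key, hs.eq]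

theorem coordPartial_iterate_comm (i i' : Fin n) (a : ℕ) {H : (Fin n → ℝ) → ℂ}
    (hH : ContDiff ℝ (a + 1 : ℕ) H) :
    coordPartial i ((coordPartial i')^[a] H) = (coordPartial i')^[a] (coordPartial i H) := by
  induction a generalizing H with
  | zero => rfl
  | succ a ih =>
    rw [Function.iterate_succ_apply, Function.iterate_succ_apply,
      ih (contDiff_coordPartial i' hH),
      coordPartial_comm i i' (hH.of_le (by norm_cast; omega))]

theorem coordPartial_listPartial_comm (i : Fin n) (l : List (Fin n)) (j : Fin n → ℕ)
    {H : (Fin n → ℝ) → ℂ} (hH : ContDiff ℝ ((l.map j).sum + 1 : ℕ) H) :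
    coordPartial i (listPartial l j H) = listPartial l j (coordPartial i H) := by
  induction l with
  | nil => rfl
  | cons i' l ih =>
    rw [List.map_cons, List.sum_cons] at hH
    rw [listPartial_cons, listPartial_cons, coordPartial_iterate_comm,
      ih (hH.of_le (by norm_cast; omega))]
    exact contDiff_listPartial l j (hH.of_le (by norm_cast; omega))

theorem iterate_coordPartial_listPartial_comm (i : Fin n) (a : ℕ) (l : List (Fin n))
    (j : Fin n → ℕ) {H : (Fin n → ℝ) → ℂ} (hH : ContDiff ℝ ((l.map j).sum + a : ℕ) H) :
    (coordPartial i)^[a] (listPartial l j H) = listPartial l j ((coordPartial i)^[a] H) := by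
  induction a generalizing H with
  | zero => rfl
  | succ a ih =>
    rw [Function.iterate_succ_apply, Function.iterate_succ_apply,
      coordPartial_listPartial_comm i l j (hH.of_le (by norm_cast; omega)),
      ih (contDiff_coordPartial i hH)]

theorem listPartial_listPartial (l : List (Fin n)) (j j' : Fin n → ℕ) {H : (Fin n → ℝ) → ℂ}
    (hH : ContDiff ℝ ((l.map j).sum + (l.map j').sum : ℕ) H) :
    listPartial l j (listPartial l j' H) = listPartial l (j + j') H := by
  induction l with
  | nil => rfl
  | cons i l ih =>
    simp only [List.map_cons, List.sum_cons] at hH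
    rw [listPartial_cons, listPartial_cons, listPartial_cons,
      ← iterate_coordPartial_listPartial_comm, ih (hH.of_le (by norm_cast; omega)),
      ← Function.iterate_add_apply]
    · rfl
    · exact contDiff_listPartial l j' (hH.of_le (by norm_cast; omega))

theorem mixedPartial_mixedPartial (j j' : Fin n → ℕ) {H : (Fin n → ℝ) → ℂ}
    (hH : ContDiff ℝ (∑ i, j i + ∑ i, j' i : ℕ) H) :
    mixedPartial j (mixedPartial j' H) = mixedPartial (j + j') H :=
  listPartial_listPartial _ j j' (by rwa [sum_map_finRange, sum_map_finRange])

theorem iterate_coordPartial_const_smul (c : ℂ) (i : Fin n) (a : ℕ) (H : (Fin n → ℝ) → ℂ) :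
    (coordPartial i)^[a] (c • H) = c • (coordPartial i)^[a] H := by
  have h1 : ∀ G : (Fin n → ℝ) → ℂ, coordPartial i (c • G) = c • coordPartial i G := by
    intro G
    ext x
    simp [coordPartial, fderiv_const_smul_field]
  induction a generalizing H with
  | zero => simp
  | succ a ih => rw [Function.iterate_succ_apply, h1, ih, Function.iterate_succ_apply]

theorem mixedPartial_const_smul (c : ℂ) (j : Fin n → ℕ) (H : (Fin n → ℝ) → ℂ) :
    mixedPartial j (c • H) = c • mixedPartial j H := by
  rw [mixedPartial_eq_listPartial, mixedPartial_eq_listPartial]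
  induction List.finRange n with
  | nil => rfl
  | cons i l ih => rw [listPartial_cons, listPartial_cons, ih, iterate_coordPartial_const_smul]

theorem hasFDerivAt_finCons_right (x₀ : ℝ) (y : Fin n → ℝ) :
    HasFDerivAt (fun y : Fin n → ℝ => (Fin.cons x₀ y : Fin (n + 1) → ℝ))
      (ContinuousLinearMap.pi (Fin.cons 0 (fun i => ContinuousLinearMap.proj i) :
        Fin (n + 1) → ((Fin n → ℝ) →L[ℝ] ℝ))) y := by
  rw [hasFDerivAt_pi']
  intro i
  refine Fin.cases ?_ (fun i => ?_) i
  · exact (hasFDerivAt_const x₀ y).congr_fderiv (by ext; simp)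
  · exact (ContinuousLinearMap.proj (R := ℝ) (φ := fun _ : Fin n => ℝ) i).hasFDerivAt.congr_fderiv
      (by ext; simp)

theorem coordPartial_finCons (i : Fin n) {H : (Fin (n + 1) → ℝ) → ℂ} (hH : Differentiable ℝ H)
    (x₀ : ℝ) (y : Fin n → ℝ) :
    coordPartial i (fun y => H (Fin.cons x₀ y)) y = coordPartial i.succ H (Fin.cons x₀ y) := by
  have h := (hH (Fin.cons x₀ y)).hasFDerivAt.comp y (hasFDerivAt_finCons_right x₀ y)
  rw [coordPartial, coordPartial]
  change fderiv ℝ (H ∘ fun y => Fin.cons x₀ y) y _ = _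
  rw [h.fderiv, ContinuousLinearMap.comp_apply]
  congr 1
  ext m
  refine Fin.cases ?_ (fun m => ?_) m
  · simp
  · simp [Pi.single_apply]

theorem contDiff_finCons_right {r : WithTop ℕ∞} {H : (Fin (n + 1) → ℝ) → ℂ}
    (hH : ContDiff ℝ r H) (x₀ : ℝ) : ContDiff ℝ r fun y : Fin n → ℝ => H (Fin.cons x₀ y) := by
  refine hH.comp (contDiff_pi.2 fun i => ?_)
  refine Fin.cases ?_ (fun i => ?_) i
  · simpa using contDiff_const
  · simpa using contDiff_apply ℝ ℝ i

theorem contDiff_finCons_left {r : WithTop ℕ∞} {H : (Fin (n + 1) → ℝ) → ℂ}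
    (hH : ContDiff ℝ r H) (y : Fin n → ℝ) : ContDiff ℝ r fun x₀ : ℝ => H (Fin.cons x₀ y) := by
  refine hH.comp (contDiff_pi.2 fun i => ?_)
  refine Fin.cases ?_ (fun i => ?_) i
  · exact contDiff_id
  · simpa using contDiff_const

theorem iterate_coordPartial_finCons (i : Fin n) (a : ℕ) {H : (Fin (n + 1) → ℝ) → ℂ}
    (hH : ContDiff ℝ (a : ℕ) H) (x₀ : ℝ) (y : Fin n → ℝ) :
    (coordPartial i)^[a] (fun y => H (Fin.cons x₀ y)) y =
      (coordPartial i.succ)^[a] H (Fin.cons x₀ y) := by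
  induction a generalizing H with
  | zero => rfl
  | succ a ih =>
    rw [Function.iterate_succ_apply, Function.iterate_succ_apply,
      ← ih (contDiff_coordPartial i.succ hH)]
    exact congrArg (fun G => (coordPartial i)^[a] G y)
      (funext fun z => coordPartial_finCons i (hH.differentiable (by norm_cast)) x₀ z)

theorem deriv_finCons {H : (Fin (n + 1) → ℝ) → ℂ} (hH : Differentiable ℝ H) (y : Fin n → ℝ)
    (x₀ : ℝ) : deriv (fun x => H (Fin.cons x y)) x₀ = coordPartial 0 H (Fin.cons x₀ y) := by
  have h1 : HasDerivAt (fun x : ℝ => (Fin.cons x y : Fin (n + 1) → ℝ)) (Pi.single 0 1) x₀ := by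
    rw [hasDerivAt_pi]
    intro i
    refine Fin.cases ?_ (fun i => ?_) i
    · exact hasDerivAt_id x₀
    · simpa using hasDerivAt_const x₀ (y i)
  exact ((hH (Fin.cons x₀ y)).hasFDerivAt.comp_hasDerivAt x₀ h1).deriv

theorem iterate_deriv_finCons (a : ℕ) {H : (Fin (n + 1) → ℝ) → ℂ} (hH : ContDiff ℝ (a : ℕ) H)
    (y : Fin n → ℝ) (x₀ : ℝ) :
    deriv^[a] (fun x => H (Fin.cons x y)) x₀ = (coordPartial 0)^[a] H (Fin.cons x₀ y) := by
  induction a generalizing H with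
  | zero => rfl
  | succ a ih =>
    rw [Function.iterate_succ_apply, Function.iterate_succ_apply,
      ← ih (contDiff_coordPartial 0 hH)]
    exact congrArg (fun G => deriv^[a] G x₀)
      (funext fun z => deriv_finCons (hH.differentiable (by norm_cast)) y z)

theorem listPartial_map_succ_finCons (l : List (Fin n)) (j : Fin (n + 1) → ℕ)
    {H : (Fin (n + 1) → ℝ) → ℂ} (hH : ContDiff ℝ ((l.map fun i => j i.succ).sum : ℕ) H)
    (x₀ : ℝ) (y : Fin n → ℝ) :
    listPartial l (fun i => j i.succ) (fun y => H (Fin.cons x₀ y)) y =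
      listPartial (l.map Fin.succ) j H (Fin.cons x₀ y) := by
  induction l generalizing y with
  | nil => rfl
  | cons i l ih =>
    rw [List.map_cons, List.sum_cons] at hH
    rw [List.map_cons, listPartial_cons, listPartial_cons, ← iterate_coordPartial_finCons]
    · exact congrArg (fun G => (coordPartial i)^[j i.succ] G y)
        (funext fun z => ih (hH.of_le (by norm_cast; omega)) z)
    · refine contDiff_listPartial _ _ ?_
      rwa [List.map_map]

/-- A mixed partial derivative in `n + 1` variables, computed slice by slice. -/
theorem mixedPartial_succ (j : Fin (n + 1) → ℕ) {H : (Fin (n + 1) → ℝ) → ℂ}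
    (hH : ContDiff ℝ (∑ i, j i : ℕ) H) (x₀ : ℝ) (y : Fin n → ℝ) :
    mixedPartial j H (Fin.cons x₀ y) =
      deriv^[j 0] (fun x => mixedPartial (fun i => j i.succ) (fun z => H (Fin.cons x z)) y) x₀ := by
  rw [Fin.sum_univ_succ] at hH
  have h1 : ((List.finRange n).map fun i => j i.succ).sum = ∑ i : Fin n, j i.succ :=
    sum_map_finRange _
  have h2 : (fun x => mixedPartial (fun i => j i.succ) (fun z => H (Fin.cons x z)) y) =
      fun x => listPartial ((List.finRange n).map Fin.succ) j H (Fin.cons x y) := by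
    ext x
    exact listPartial_map_succ_finCons _ j
      (hH.of_le (by rw [h1]; norm_cast; omega)) x y
  rw [h2, iterate_deriv_finCons, mixedPartial_eq_listPartial, List.finRange_succ, listPartial_cons]
  refine contDiff_listPartial _ _ ?_
  rw [List.map_map, Function.comp_def, h1]
  exact hH

end Partial

theorem measurableSet_stdOrthant (n : ℕ) (h : Fin n → ℝ) : MeasurableSet (stdOrthant n h) := by
  have : stdOrthant n h = Set.pi Set.univ fun i => Set.Ici (-h i) := by
    ext t
    simp only [stdOrthant, Set.mem_pi, Set.mem_univ, forall_const, Set.mem_Ici]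
    rfl
  rw [this]
  exact MeasurableSet.univ_pi fun i => measurableSet_Ici

theorem continuous_insertNth {n : ℕ} (i : Fin (n + 1)) :
    Continuous fun p : ℝ × (Fin n → ℝ) => (i.insertNth p.1 p.2 : Fin (n + 1) → ℝ) :=
  Continuous.finInsertNth (A := fun _ => ℝ) i continuous_fst continuous_snd

/-- Fubini on an orthant, singling out the `i`-th coordinate. -/
theorem setIntegral_stdOrthant_succ {n : ℕ} (i : Fin (n + 1)) {Φ : (Fin (n + 1) → ℝ) → ℂ}
    (hΦ : Integrable Φ) (h : Fin (n + 1) → ℝ) :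
    IntegrableOn (fun p : ℝ × (Fin n → ℝ) => Φ (i.insertNth p.1 p.2))
      (Set.Ici (-h i) ×ˢ stdOrthant n fun j => h (i.succAbove j)) (volume.prod volume) ∧
    ∫ t in stdOrthant (n + 1) h, Φ t =
      ∫ p in Set.Ici (-h i) ×ˢ stdOrthant n fun j => h (i.succAbove j),
        Φ (i.insertNth p.1 p.2) ∂(volume.prod volume) := by
  have hmp := (volume_preserving_piFinSuccAbove (fun _ : Fin (n + 1) => ℝ) i).symm
  have he : ∀ p : ℝ × (Fin n → ℝ), (MeasurableEquiv.piFinSuccAbove (fun _ : Fin (n + 1) => ℝ) i).symm p =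
      i.insertNth p.1 p.2 := fun p => rfl
  have hpre : (MeasurableEquiv.piFinSuccAbove (fun _ : Fin (n + 1) => ℝ) i).symm ⁻¹'
      stdOrthant (n + 1) h = Set.Ici (-h i) ×ˢ stdOrthant n fun j => h (i.succAbove j) := by
    ext p
    simp only [Set.mem_preimage, he, stdOrthant, Set.mem_ofPred_eq, Set.mem_prod, Set.mem_Ici,
      Fin.forall_iff_succAbove i, Fin.insertNth_apply_same, Fin.insertNth_apply_succAbove]
  constructor
  · exact (hmp.integrable_comp_of_integrable hΦ).integrableOn
  · rw [← hmp.setIntegral_preimage_emb (MeasurableEquiv.measurableEmbedding _), hpre]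
    rfl

theorem setIntegral_stdOrthant_succ_left {n : ℕ} (i : Fin (n + 1)) {Φ : (Fin (n + 1) → ℝ) → ℂ}
    (hΦ : Integrable Φ) (h : Fin (n + 1) → ℝ) :
    ∫ t in stdOrthant (n + 1) h, Φ t =
      ∫ s in Set.Ici (-h i), ∫ y in stdOrthant n fun j => h (i.succAbove j),
        Φ (i.insertNth s y) := by
  obtain ⟨h1, h2⟩ := setIntegral_stdOrthant_succ i hΦ h
  rw [h2, setIntegral_prod _ h1]

theorem setIntegral_stdOrthant_succ_right {n : ℕ} (i : Fin (n + 1)) {Φ : (Fin (n + 1) → ℝ) → ℂ}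
    (hΦ : Integrable Φ) (h : Fin (n + 1) → ℝ) :
    IntegrableOn (fun y => ∫ s in Set.Ici (-h i), Φ (i.insertNth s y))
      (stdOrthant n fun j => h (i.succAbove j)) ∧
    ∫ t in stdOrthant (n + 1) h, Φ t =
      ∫ y in stdOrthant n fun j => h (i.succAbove j), ∫ s in Set.Ici (-h i),
        Φ (i.insertNth s y) := by
  obtain ⟨h1, h2⟩ := setIntegral_stdOrthant_succ i hΦ h
  rw [IntegrableOn, ← Measure.prod_restrict] at h1
  refine ⟨h1.integral_prod_right, ?_⟩
  rw [h2, ← Measure.prod_restrict, integral_prod_symm _ h1]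

theorem hasCompactSupport_finCons {n : ℕ} {g : (Fin (n + 1) → ℝ) → ℂ} (hg : HasCompactSupport g)
    (x : ℝ) : HasCompactSupport fun y : Fin n → ℝ => g (Fin.cons x y) := by
  have hcl : Continuous fun t : Fin (n + 1) → ℝ => fun i : Fin n => t i.succ := by fun_prop
  refine HasCompactSupport.intro (hg.isCompact.image hcl) fun y hy => ?_
  by_contra hc
  refine hy ⟨Fin.cons x y, subset_tsupport g hc, ?_⟩
  ext i
  simp

theorem sum_pi_finSucc {n : ℕ} {X : Type*} [Fintype X] (f : (Fin (n + 1) → X) → ℂ) :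
    ∑ m, f m = ∑ x, ∑ m : Fin n → X, f (Fin.cons x m) := by
  rw [← Fintype.sum_prod_type' (f := fun (x : X) (m : Fin n → X) => f (Fin.cons x m))]
  exact (Fintype.sum_equiv (Fin.consEquiv fun _ : Fin (n + 1) => X) _ _ fun _ => rfl).symm

/-- Tensorization of one-dimensional summation formulas. -/
theorem sum_prod_mul_eq_sum_integral {ι : Type*} [Fintype ι] (k : ℕ) (o : ι → ℕ)
    (ho : ∀ s, o s ≤ k) (B : ℝ) (M : ℕ) {n : ℕ} (w : Fin n → ℕ → ℂ) (W : Fin n → ι → ℝ → ℂ)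
    (hW : ∀ i s, Continuous (W i s))
    (hwW : ∀ i (F : ℝ → ℂ), ContDiff ℝ (k : ℕ) F → (∀ t, B < t → F t = 0) →
      ∑ m ∈ Finset.range (M + 1), w i m * F m =
        ∑ s, ∫ t in Set.Ici (0 : ℝ), W i s t * deriv^[o s] F t)
    {g : (Fin n → ℝ) → ℂ} (hg : ContDiff ℝ (n * k : ℕ) g) (hgc : HasCompactSupport g)
    (hgB : ∀ x i, B < x i → g x = 0) :
    ∑ m : Fin n → Fin (M + 1), (∏ i, w i (m i)) * g (fun i => (m i : ℕ)) =
      ∑ σ : Fin n → ι, ∫ t in stdOrthant n 0,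
        (∏ i, W i (σ i) (t i)) * mixedPartial (fun i => o (σ i)) g t := by
  induction n with
  | zero =>
    have h1 : ∀ h, stdOrthant 0 h = Set.univ := fun h => Set.eq_univ_of_forall fun t i => i.elim0
    have h2 : (volume : Measure (Fin 0 → ℝ)) = Measure.dirac default := Measure.volume_pi_eq_dirac _
    have h3 : ∀ x : Fin 0 → ℝ, g x = g default := fun x => congrArg g (Subsingleton.elim _ _)
    simp [h1, h2, mixedPartial, h3]
  | succ n ih =>
    have hk1 : (n + 1) * k = k + n * k := by ring
    have hsum : ∀ σ : Fin n → ι, ∑ i, o (σ i) ≤ n * k := fun σ => by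
      simpa using Finset.sum_le_sum fun i (_ : i ∈ Finset.univ) => ho (σ i)
    -- the slices
    have hslice : ∀ x : ℝ, ContDiff ℝ (n * k : ℕ) fun y : Fin n → ℝ => g (Fin.cons x y) :=
      fun x => contDiff_finCons_right (hg.of_le (by norm_cast; omega)) x
    have ihx := fun x : ℝ => ih (fun i => w i.succ) (fun i => W i.succ) (fun i s => hW _ s)
      (fun i => hwW i.succ) (hslice x) (hasCompactSupport_finCons hgc x)
      (fun y i hy => hgB _ i.succ (by simpa using hy))
    have hcontW : ∀ σ : Fin n → ι, Continuous fun t : Fin n → ℝ => ∏ i, W i.succ (σ i) (t i) :=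
      fun σ => continuous_finsetProd _ fun i _ => (hW _ _).comp (continuous_apply i)
    have hint : ∀ (x : ℝ) (σ : Fin n → ι), Integrable fun t : Fin n → ℝ =>
        (∏ i, W i.succ (σ i) (t i)) *
          mixedPartial (fun i => o (σ i)) (fun y => g (Fin.cons x y)) t := by
      intro x σ
      have h0 : ContDiff ℝ (0 : ℕ) (mixedPartial (fun i => o (σ i)) fun y => g (Fin.cons x y)) :=
        contDiff_mixedPartial _ ((hslice x).of_le (by norm_cast; have := hsum σ; omega))
      exact ((hcontW σ).mul h0.continuous).integrable_of_hasCompactSupport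
        (hasCompactSupport_mixedPartial _ (hasCompactSupport_finCons hgc x)).mul_left
    have hK : ∀ (σ : Fin n → ι) (y : Fin n → ℝ),
        ContDiff ℝ (k : ℕ)
          fun x : ℝ => mixedPartial (fun i => o (σ i)) (fun y => g (Fin.cons x y)) y := by
      intro σ y
      have hs : ∑ i, (Fin.cons 0 fun i => o (σ i) : Fin (n + 1) → ℕ) i = ∑ i, o (σ i) := by
        simp [Fin.sum_univ_succ]
      have h1 : ContDiff ℝ (k : ℕ) (mixedPartial (Fin.cons 0 fun i => o (σ i)) g) :=
        contDiff_mixedPartial _ (hg.of_le (by rw [hs]; norm_cast; have := hsum σ; omega))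
      convert contDiff_finCons_left h1 y using 2 with x
      rw [mixedPartial_succ]
      · simp
      · exact hg.of_le (by rw [hs]; norm_cast; have := hsum σ; omega)
    have hKB : ∀ (σ : Fin n → ι) (y : Fin n → ℝ) (x : ℝ), B < x →
        mixedPartial (fun i => o (σ i)) (fun y => g (Fin.cons x y)) y = 0 := by
      intro σ y x hx
      have : (fun y : Fin n → ℝ => g (Fin.cons x y)) = (0 : ℂ) • fun _ => 0 := by
        ext z
        simpa using hgB (Fin.cons x z) 0 (by simpa using hx)
      rw [this, mixedPartial_const_smul]
      simp
    have hmain : ∀ σ : Fin (n + 1) → ι, Integrable fun t : Fin (n + 1) → ℝ =>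
        (∏ i, W i (σ i) (t i)) * mixedPartial (fun i => o (σ i)) g t := by
      intro σ
      have hs : ∑ i, o (σ i) ≤ (n + 1) * k := by
        simpa using Finset.sum_le_sum fun i (_ : i ∈ Finset.univ) => ho (σ i)
      have h0 : ContDiff ℝ (0 : ℕ) (mixedPartial (fun i => o (σ i)) g) :=
        contDiff_mixedPartial _ (hg.of_le (by norm_cast; omega))
      have hc : Continuous fun t : Fin (n + 1) → ℝ => ∏ i, W i (σ i) (t i) :=
        continuous_finsetProd _ fun i _ => (hW _ _).comp (continuous_apply i)
      exact (hc.mul h0.continuous).integrable_of_hasCompactSupport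
        (hasCompactSupport_mixedPartial _ hgc).mul_left
    calc ∑ m : Fin (n + 1) → Fin (M + 1), (∏ i, w i (m i)) * g (fun i => (m i : ℕ))
        = ∑ x : Fin (M + 1), w 0 x * ∑ m : Fin n → Fin (M + 1),
            (∏ i, w i.succ (m i)) * g (Fin.cons ((x : ℕ) : ℝ) fun i => (m i : ℕ)) := by
          rw [sum_pi_finSucc]
          refine Finset.sum_congr rfl fun x _ => ?_
          rw [Finset.mul_sum]
          refine Finset.sum_congr rfl fun m _ => ?_
          rw [Fin.prod_univ_succ, mul_assoc]
          simp only [Fin.cons_zero, Fin.cons_succ]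
          congr 3
          ext i
          refine Fin.cases ?_ (fun i => ?_) i <;> simp
      _ = ∑ x ∈ Finset.range (M + 1), w 0 x * ∑ σ : Fin n → ι, ∫ t in stdOrthant n 0,
            (∏ i, W i.succ (σ i) (t i)) *
              mixedPartial (fun i => o (σ i)) (fun y => g (Fin.cons (x : ℝ) y)) t := by
          rw [← Fin.sum_univ_eq_sum_range (fun x : ℕ => w 0 x * ∑ σ : Fin n → ι,
            ∫ t in stdOrthant n 0, (∏ i, W i.succ (σ i) (t i)) *
              mixedPartial (fun i => o (σ i)) (fun y => g (Fin.cons (x : ℝ) y)) t)]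
          exact Finset.sum_congr rfl fun x _ => by rw [ihx]
      _ = ∑ σ : Fin n → ι, ∫ t in stdOrthant n 0, (∏ i, W i.succ (σ i) (t i)) *
            ∑ x ∈ Finset.range (M + 1), w 0 x *
              mixedPartial (fun i => o (σ i)) (fun y => g (Fin.cons (x : ℝ) y)) t := by
          simp only [Finset.mul_sum]
          rw [Finset.sum_comm]
          refine Finset.sum_congr rfl fun σ _ => ?_
          rw [integral_finsetSum]
          · refine Finset.sum_congr rfl fun x _ => ?_
            rw [← integral_const_mul]
            congr 1
            ext t
            ring
          · intro x _
            refine (((hint x σ).const_mul (w 0 x)).integrableOn).congr ?_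
            exact Filter.Eventually.of_forall fun t => by ring
      _ = ∑ σ : Fin n → ι, ∫ t in stdOrthant n 0, ∑ s, ∫ x in Set.Ici (0 : ℝ),
            (∏ i, W i (Fin.cons s σ i : ι) ((Fin.cons x t : Fin (n + 1) → ℝ) i)) *
              mixedPartial (fun i => o ((Fin.cons s σ : Fin (n + 1) → ι) i)) g (Fin.cons x t) := by
          refine Finset.sum_congr rfl fun σ _ => ?_
          congr 1
          ext t
          rw [hwW 0 _ (hK σ t) (hKB σ t), Finset.mul_sum]
          refine Finset.sum_congr rfl fun s _ => ?_
          rw [← integral_const_mul]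
          congr 1
          ext x
          rw [mixedPartial_succ, Fin.prod_univ_succ]
          · simp only [Fin.cons_zero, Fin.cons_succ]
            ring
          · refine hg.of_le ?_
            rw [Fin.sum_univ_succ]
            simp only [Fin.cons_zero, Fin.cons_succ]
            norm_cast
            have := hsum σ
            have := ho s
            omega
      _ = ∑ σ : Fin n → ι, ∑ s, ∫ t in stdOrthant (n + 1) 0,
            (∏ i, W i (Fin.cons s σ i : ι) (t i)) *
              mixedPartial (fun i => o ((Fin.cons s σ : Fin (n + 1) → ι) i)) g t := by
          refine Finset.sum_congr rfl fun σ _ => ?_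
          have hF := fun s => setIntegral_stdOrthant_succ_right 0 (hmain (Fin.cons s σ)) 0
          simp only [Fin.insertNth_zero', Pi.zero_apply, neg_zero] at hF
          rw [integral_finsetSum]
          · exact Finset.sum_congr rfl fun s _ => (hF s).2.symm
          · exact fun s _ => (hF s).1
      _ = _ := by
          rw [sum_pi_finSucc, Finset.sum_comm]

theorem hasFDerivAt_of_continuous_partials {n : ℕ} {f : (Fin n → ℝ) → ℂ}
    {p : Fin n → (Fin n → ℝ) → ℂ} (hp : ∀ i, Continuous (p i))
    (hd : ∀ i x, HasDerivAt (fun s => f (Function.update x i s)) (p i x) (x i))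
    (x : Fin n → ℝ) :
    HasFDerivAt f (∑ i, (ContinuousLinearMap.proj (R := ℝ) (φ := fun _ : Fin n => ℝ) i).smulRight
      (p i x)) x := by
  induction n with
  | zero => exact hasFDerivAt_of_subsingleton f x |>.congr_fderiv (by simp)
  | succ n ih =>
    have hcons : ∀ i : Fin (n + 1), Continuous fun v : ℝ × (Fin n → ℝ) =>
        p i (Fin.cons v.1 v.2) := fun i => (hp i).comp
          (Continuous.finCons (A := fun _ => ℝ) continuous_fst continuous_snd)
    have key := hasStrictFDerivAt_uncurry_coprod (𝕜 := ℝ) (u := (x 0, Fin.tail x))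
      (f := fun a b => f (Fin.cons a b))
      (f₁ := fun a b => ContinuousLinearMap.toSpanSingleton ℝ (p 0 (Fin.cons a b)))
      (f₂ := fun a b => ∑ i : Fin n,
        (ContinuousLinearMap.proj (R := ℝ) (φ := fun _ : Fin n => ℝ) i).smulRight
          (p i.succ (Fin.cons a b)))
      (Filter.Eventually.of_forall fun v => by
        have h := hd 0 (Fin.cons v.1 v.2)
        simp only [Fin.update_cons_zero, Fin.cons_zero] at h
        exact h.hasFDerivAt)
      (Filter.Eventually.of_forall fun v => by
        refine ih (f := fun b => f (Fin.cons v.1 b)) (p := fun i b => p i.succ (Fin.cons v.1 b))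
          (fun i => (hp _).comp
            (Continuous.finCons (A := fun _ => ℝ) continuous_const continuous_id)) (fun i y => ?_) v.2
        have h := hd i.succ (Fin.cons v.1 y)
        simpa only [Fin.cons_update, Fin.cons_succ] using h)
      (by
        refine Continuous.continuousAt ?_
        exact (ContinuousLinearMap.toSpanSingletonCLE (𝕜 := ℝ) (E := ℂ)).continuous.comp (hcons 0))
      (by
        have hc : Continuous fun v : ℝ × (Fin n → ℝ) => ∑ i : Fin n,
            (ContinuousLinearMap.proj (R := ℝ) (φ := fun _ : Fin n => ℝ) i).smulRight
              (p i.succ (Fin.cons v.1 v.2)) := continuous_finsetSum _ fun i _ => (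
          (ContinuousLinearMap.smulRightL ℝ (Fin n → ℝ) ℂ
            (ContinuousLinearMap.proj i)).continuous).comp (hcons i.succ)
        exact hc.continuousAt)
    have hπ : HasFDerivAt (fun t : Fin (n + 1) → ℝ => (t 0, Fin.tail t))
        ((ContinuousLinearMap.proj 0).prod (ContinuousLinearMap.pi fun i : Fin n =>
          ContinuousLinearMap.proj i.succ)) x :=
      ((ContinuousLinearMap.proj (R := ℝ) (φ := fun _ : Fin (n + 1) => ℝ) 0).prod
        (ContinuousLinearMap.pi fun i : Fin n => ContinuousLinearMap.proj i.succ)).hasFDerivAt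
    have := HasFDerivAt.comp x key.hasFDerivAt hπ
    refine (this.congr_fderiv ?_).congr_of_eventuallyEq (Filter.Eventually.of_forall fun t => ?_)
    · ext w
      simp [Function.HasUncurry.uncurry, Fin.sum_univ_succ, Fin.cons_self_tail]
    · simp [Function.HasUncurry.uncurry, Fin.cons_self_tail]

theorem continuous_setIntegral_stdOrthant {n : ℕ} {Φ : ℝ × (Fin n → ℝ) → ℂ} (hΦ : Continuous Φ) (hc : HasCompactSupport Φ) :
    Continuous fun v : ℝ × (Fin n → ℝ) => ∫ t in stdOrthant n v.2, Φ (v.1, t) := by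
  have htr : ∀ v : ℝ × (Fin n → ℝ), ∫ t in stdOrthant n v.2, Φ (v.1, t) =
      ∫ t in stdOrthant n 0, Φ (v.1, t - v.2) := by
    intro v
    rw [← integral_indicator (measurableSet_stdOrthant _ _),
      ← integral_indicator (measurableSet_stdOrthant _ _),
      ← integral_sub_right_eq_self _ v.2]
    congr 1
    ext t
    simp [Set.indicator, stdOrthant]
  simp only [htr]
  rw [continuous_iff_continuousAt]
  intro v₀
  have hK := ((hc.isCompact.image continuous_snd).prod (isCompact_closedBall v₀.2 1)).image
    continuous_add
  refine ContinuousOn.continuousAt (s := Set.univ ×ˢ Metric.closedBall v₀.2 1)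
    (continuousOn_integral_of_compact_support hK ?_ ?_)
    (prod_mem_nhds Filter.univ_mem (Metric.closedBall_mem_nhds _ one_pos))
  · exact (hΦ.comp (by fun_prop : Continuous fun w : (ℝ × (Fin n → ℝ)) × (Fin n → ℝ) =>
      (w.1.1, w.2 - w.1.2))).continuousOn
  · intro v t hv ht
    by_contra hne
    exact ht ⟨(t - v.2, v.2), ⟨⟨_, subset_tsupport Φ hne, rfl⟩, hv.2⟩, sub_add_cancel _ _⟩

theorem hasDerivAt_setIntegral_Ici_neg {K : ℝ → ℂ} (hK : Continuous K) (hi : Integrable K)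
    (x : ℝ) : HasDerivAt (fun s => ∫ t in Set.Ici (-s), K t) (K (-x)) x := by
  have h1 : (fun s => ∫ t in Set.Ici (-s), K t) =
      fun s => (∫ t in Set.Ioi 0, K t) - ∫ t in (0 : ℝ)..(-s), K t := by
    ext s
    rw [integral_Ici_eq_integral_Ioi,
      ← intervalIntegral.integral_Ioi_sub_Ioi' hi.integrableOn hi.integrableOn, sub_sub_cancel]
  rw [h1]
  have h2 := (intervalIntegral.integral_hasDerivAt_right (hK.intervalIntegrable 0 (-x))
    (hK.stronglyMeasurableAtFilter _ _) hK.continuousAt).scomp x (hasDerivAt_neg x)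
  simpa using (h2.const_sub (∫ t in Set.Ioi 0, K t))

/-- The partial derivatives of the integral over an orthant with respect to its parameters. -/
theorem hasFDerivAt_setIntegral_stdOrthant {n : ℕ} {Φ : (Fin (n + 1) → ℝ) → ℂ}
    (hΦ : Continuous Φ) (hc : HasCompactSupport Φ) (h : Fin (n + 1) → ℝ) :
    HasFDerivAt (fun h => ∫ t in stdOrthant (n + 1) h, Φ t)
      (∑ i, (ContinuousLinearMap.proj (R := ℝ) (φ := fun _ : Fin (n + 1) => ℝ) i).smulRight
        (∫ y in stdOrthant n fun j => h (i.succAbove j), Φ (i.insertNth (-h i) y))) h := by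
  have hI : Integrable Φ := hΦ.integrable_of_hasCompactSupport hc
  have hcs : ∀ i : Fin (n + 1), HasCompactSupport
      fun p : ℝ × (Fin n → ℝ) => Φ (i.insertNth p.1 p.2) := by
    intro i
    have hcl : Continuous fun t : Fin (n + 1) → ℝ => (t i, fun j : Fin n => t (i.succAbove j)) := by
      fun_prop
    refine HasCompactSupport.intro (hc.isCompact.image hcl) fun p hp => ?_
    by_contra hne
    refine hp ⟨i.insertNth p.1 p.2, subset_tsupport Φ hne, ?_⟩
    simp
  have hcont : ∀ i : Fin (n + 1), Continuous fun v : ℝ × (Fin n → ℝ) =>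
      ∫ y in stdOrthant n v.2, Φ (i.insertNth v.1 y) := fun i =>
    continuous_setIntegral_stdOrthant (hΦ.comp (continuous_insertNth i)) (hcs i)
  refine hasFDerivAt_of_continuous_partials (p := fun i h =>
    ∫ y in stdOrthant n fun j => h (i.succAbove j), Φ (i.insertNth (-h i) y)) ?_ ?_ h
  · intro i
    exact (hcont i).comp (by fun_prop : Continuous fun h : Fin (n + 1) → ℝ =>
      (-h i, fun j : Fin n => h (i.succAbove j)))
  · intro i x
    have hK : Continuous fun s : ℝ =>
        ∫ y in stdOrthant n fun j => x (i.succAbove j), Φ (i.insertNth s y) :=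
      (hcont i).comp (by fun_prop : Continuous fun s : ℝ => (s, fun j : Fin n => x (i.succAbove j)))
    have hKc : HasCompactSupport fun s : ℝ =>
        ∫ y in stdOrthant n fun j => x (i.succAbove j), Φ (i.insertNth s y) := by
      refine HasCompactSupport.intro ((hcs i).isCompact.image continuous_fst) fun s hs => ?_
      have : ∀ y : Fin n → ℝ, Φ (i.insertNth s y) = 0 := by
        intro y
        by_contra hne
        exact hs ⟨(s, y), subset_tsupport _ hne, rfl⟩
      simp [this]
    convert hasDerivAt_setIntegral_Ici_neg hK (hK.integrable_of_hasCompactSupport hKc) (x i)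
      using 2 with s
    rw [setIntegral_stdOrthant_succ_left i hI]
    simp

theorem deriv_insertNth {n : ℕ} (i : Fin (n + 1)) {G : (Fin (n + 1) → ℝ) → ℂ}
    (hG : Differentiable ℝ G) (y : Fin n → ℝ) (s : ℝ) :
    deriv (fun s => G (i.insertNth s y)) s = coordPartial i G (i.insertNth s y) := by
  have h1 : HasDerivAt (fun s : ℝ => (i.insertNth s y : Fin (n + 1) → ℝ)) (Pi.single i 1) s := by
    rw [hasDerivAt_pi, Fin.forall_iff_succAbove i]
    constructor
    · simpa using hasDerivAt_id' s
    · intro j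
      simpa using hasDerivAt_const s (y j)
  exact ((hG (i.insertNth s y)).hasFDerivAt.comp_hasDerivAt s h1).deriv

/-- Differentiating an integral over an orthant amounts to differentiating the integrand. -/
theorem coordPartial_setIntegral_stdOrthant {n : ℕ} (J : Finset (Fin n)) {W : Fin n → ℝ → ℂ}
    (hW : ∀ i, Continuous (W i)) {i : Fin n} (hi : i ∉ J) {G : (Fin n → ℝ) → ℂ}
    (hG : ContDiff ℝ 1 G) (hc : HasCompactSupport G) :
    coordPartial i (fun h => ∫ t in stdOrthant n h, (∏ j ∈ J, W j (t j)) * G t) =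
      (-1 : ℂ) • fun h => ∫ t in stdOrthant n h, (∏ j ∈ J, W j (t j)) * coordPartial i G t := by
  cases n with
  | zero => exact i.elim0
  | succ n =>
    have hP : Continuous fun t : Fin (n + 1) → ℝ => ∏ j ∈ J, W j (t j) :=
      continuous_finsetProd _ fun j _ => (hW j).comp (continuous_apply j)
    have hPi : ∀ s s' (y : Fin n → ℝ), ∏ j ∈ J, W j ((i.insertNth s y : Fin (n + 1) → ℝ) j) =
        ∏ j ∈ J, W j ((i.insertNth s' y : Fin (n + 1) → ℝ) j) := by
      intro s s' y
      refine Finset.prod_congr rfl fun j hj => ?_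
      obtain ⟨j, rfl⟩ := Fin.exists_succAbove_eq (x := j) (y := i) (by rintro rfl; exact hi hj)
      simp
    have hG' : Continuous (coordPartial i G) :=
      (contDiff_coordPartial i (r := 0) (by simpa using hG)).continuous
    have hPG : Continuous fun t => (∏ j ∈ J, W j (t j)) * G t := hP.mul hG.continuous
    have hI : Integrable fun t => (∏ j ∈ J, W j (t j)) * coordPartial i G t :=
      (hP.mul hG').integrable_of_hasCompactSupport (hasCompactSupport_coordPartial i hc).mul_left
    ext h
    rw [coordPartial,
      (hasFDerivAt_setIntegral_stdOrthant hPG hc.mul_left h).fderiv,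
      Pi.smul_apply, (setIntegral_stdOrthant_succ_right i hI h).2]
    simp only [sum_apply, ContinuousLinearMap.smulRight_apply,
      ContinuousLinearMap.proj_apply, Pi.single_apply, ite_smul, one_smul, zero_smul,
      Finset.sum_ite_eq', Finset.mem_univ, if_true, smul_eq_mul]
    rw [← integral_const_mul]
    congr 1
    ext y
    have hs1 : ContDiff ℝ 1 fun s : ℝ => G (i.insertNth s y) := by
      refine hG.comp (contDiff_pi.2 ?_)
      rw [Fin.forall_iff_succAbove i]
      constructor
      · simpa using contDiff_fun_id
      · intro j
        simpa using contDiff_const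
    have hs2 : HasCompactSupport fun s : ℝ => G (i.insertNth s y) := by
      refine HasCompactSupport.intro (hc.isCompact.image (continuous_apply i)) fun s hs => ?_
      by_contra hne
      exact hs ⟨_, subset_tsupport G hne, by simp⟩
    have h3 := hs2.integral_Ioi_deriv_eq hs1 (-h i)
    rw [integral_Ici_eq_integral_Ioi]
    simp only [deriv_insertNth i (hG.differentiable one_ne_zero) y] at h3
    simp_rw [hPi _ (-h i) y]
    rw [integral_const_mul, h3]
    ring

theorem coordPartial_iterate_setIntegral_stdOrthant {n : ℕ} (J : Finset (Fin n))
    {W : Fin n → ℝ → ℂ} (hW : ∀ i, Continuous (W i)) {i : Fin n} (a : ℕ) (hi : i ∈ J → a = 0)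
    {G : (Fin n → ℝ) → ℂ} (hG : ContDiff ℝ (a : ℕ) G) (hc : HasCompactSupport G) :
    (coordPartial i)^[a] (fun h => ∫ t in stdOrthant n h, (∏ j ∈ J, W j (t j)) * G t) =
      (-1 : ℂ) ^ a • fun h => ∫ t in stdOrthant n h,
        (∏ j ∈ J, W j (t j)) * (coordPartial i)^[a] G t := by
  induction a generalizing G with
  | zero => simp
  | succ a ih =>
    have hi' : i ∉ J := fun h => Nat.succ_ne_zero a (hi h)
    rw [Function.iterate_succ_apply, Function.iterate_succ_apply,
      coordPartial_setIntegral_stdOrthant J hW hi' (hG.of_le (by norm_cast; omega)) hc,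
      iterate_coordPartial_const_smul,
      ih (fun h => absurd h hi') (contDiff_coordPartial i hG) (hasCompactSupport_coordPartial i hc),
      smul_smul, pow_succ']

/-- Iterated derivatives of an integral over an orthant at which the integrand is
differentiated. -/
theorem mixedPartial_setIntegral_stdOrthant {n : ℕ} (J : Finset (Fin n)) {W : Fin n → ℝ → ℂ}
    (hW : ∀ i, Continuous (W i)) (j : Fin n → ℕ) (hj : ∀ i ∈ J, j i = 0) {G : (Fin n → ℝ) → ℂ}
    (hG : ContDiff ℝ (∑ i, j i : ℕ) G) (hc : HasCompactSupport G) :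
    mixedPartial j (fun h => ∫ t in stdOrthant n h, (∏ i ∈ J, W i (t i)) * G t) =
      (-1 : ℂ) ^ (∑ i, j i) • fun h => ∫ t in stdOrthant n h,
        (∏ i ∈ J, W i (t i)) * mixedPartial j G t := by
  rw [mixedPartial_eq_listPartial, mixedPartial_eq_listPartial]
  rw [← sum_map_finRange] at hG ⊢
  generalize List.finRange n = l at hG ⊢
  induction l with
  | nil => simp [listPartial]
  | cons i l ih =>
    rw [List.map_cons, List.sum_cons] at hG ⊢
    rw [listPartial_cons, listPartial_cons, ih (hG.of_le (by norm_cast; omega)),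
      iterate_coordPartial_const_smul,
      coordPartial_iterate_setIntegral_stdOrthant J hW _ (hj i)
        (contDiff_listPartial l j hG) (hasCompactSupport_listPartial l j hc),
      smul_smul, pow_add, mul_comm]

theorem sum_pi_prod_eq_sum_finset {n : ℕ} {X : Type*} [Fintype X]
    (A : (Fin n → Bool × X) → ℂ) :
    ∑ σ, A σ = ∑ I : Finset (Fin n), ∑ j : Fin n → X, A fun i => (decide (i ∈ I), j i) := by
  rw [← Fintype.sum_prod_type' (f := fun (I : Finset (Fin n)) (j : Fin n → X) =>
    A fun i => (decide (i ∈ I), j i))]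
  refine (Fintype.sum_bijective
    (fun p : Finset (Fin n) × (Fin n → X) => fun i => (decide (i ∈ p.1), p.2 i)) ⟨?_, ?_⟩ _ _
    fun _ => rfl).symm
  · rintro ⟨I, j⟩ ⟨I', j'⟩ h
    simp only [funext_iff, Prod.mk.injEq, decide_eq_decide] at h
    exact Prod.ext (Finset.ext fun i => (h i).1) (funext fun i => (h i).2)
  · intro σ
    refine ⟨(Finset.univ.filter fun i => (σ i).1 = true, fun i => (σ i).2), ?_⟩
    ext i <;> simp

theorem opApply_eq_sum {n : ℕ} (c : Fin n → ℕ → ℂ) (k : ℕ) (H : (Fin n → ℝ) → ℂ) :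
    opApply c k H = ∑ j : Fin n → Fin (k + 1),
      (∏ i, c i (j i)) * mixedPartial (fun i => (j i : ℕ)) H 0 := by
  rw [opApply]
  refine (Finset.sum_bij (fun (j : Fin n → Fin (k + 1)) _ => fun i => (j i : ℕ)) ?_ ?_ ?_ ?_).symm
  · intro j _
    simpa [Fintype.mem_piFinset] using fun i => Nat.lt_succ_iff.1 (j i).2
  · intro j _ j' _ h
    ext i
    exact congrFun h i
  · intro j hj
    rw [Fintype.mem_piFinset] at hj
    exact ⟨fun i => ⟨j i, Finset.mem_range.1 (hj i)⟩, Finset.mem_univ _, rfl⟩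
  · intro j _
    rfl

theorem opApply_const_smul {n : ℕ} (c : Fin n → ℕ → ℂ) (k : ℕ) (a : ℂ)
    (H : (Fin n → ℝ) → ℂ) : opApply c k (a • H) = a * opApply c k H := by
  rw [opApply, opApply, Finset.mul_sum]
  refine Finset.sum_congr rfl fun j _ => ?_
  rw [mixedPartial_const_smul, Pi.smul_apply, smul_eq_mul]
  ring

theorem mixedPartial_zero {n : ℕ} (H : (Fin n → ℝ) → ℂ) : mixedPartial (fun _ => 0) H = H := by
  rw [mixedPartial_eq_listPartial]
  induction List.finRange n with
  | nil => rfl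
  | cons i l ih => rw [listPartial_cons, ih]; rfl

/-- The main term together with the remainder as one sum over all sets of coordinates. -/
theorem opApply_add_orthantRemainder {n : ℕ} (q lam : Fin n → ℂ) (Q : Fin n → ℕ → ℝ → ℂ) (k : ℕ)
    (g : (Fin n → ℝ) → ℂ) :
    opApply (fun i => Ncoeff (q i) (lam i) (Q i) k) k (fun h => ∫ t in stdOrthant n h, g t) +
        orthantRemainder q lam Q k g =
      ∑ I : Finset (Fin n), (-1 : ℂ) ^ ((k - 1) * (n - I.card)) *
        opApply
          (fun i => if i ∈ I then Ncoeff (q i) (lam i) (Q i) k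
            else fun j => if j = 0 then 1 else 0) k
          (fun h => ∫ t in stdOrthant n h,
            (∏ i ∈ Iᶜ, Q i k (t i)) *
              mixedPartial (fun i => if i ∈ I then 0 else k) g t) := by
  rw [orthantRemainder, Finset.powerset_univ, ← Finset.add_sum_erase _ _
    (Finset.mem_univ (Finset.univ : Finset (Fin n)))]
  simp [mixedPartial_zero]

theorem prod_emWeight {n : ℕ} (q lam : Fin n → ℂ) (Q : Fin n → ℕ → ℝ → ℂ) (k : ℕ)
    (I : Finset (Fin n)) (j : Fin n → Fin (k + 1)) (hj : ∀ i ∉ I, (j i : ℕ) = 0)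
    (t : Fin n → ℝ) :
    ∏ i, emWeight (q i) (lam i) (Q i) k (decide (i ∈ I), j i) (t i) =
      (-1) ^ ((k - 1) * (n - I.card)) * (∏ i, (if i ∈ I then Ncoeff (q i) (lam i) (Q i) k
            else fun j => if j = 0 then 1 else 0) (j i)) * (-1) ^ (∑ i, (j i : ℕ)) *
        ∏ i ∈ Iᶜ, Q i k (t i) := by
  have h1 : ∏ i ∈ I, emWeight (q i) (lam i) (Q i) k (decide (i ∈ I), j i) (t i) =
      (∏ i ∈ I, (-1) ^ (j i : ℕ)) * ∏ i ∈ I, Ncoeff (q i) (lam i) (Q i) k (j i) := by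
    rw [← Finset.prod_mul_distrib]
    exact Finset.prod_congr rfl fun i hi => by simp [emWeight, hi]
  have h2 : ∏ i ∈ Iᶜ, emWeight (q i) (lam i) (Q i) k (decide (i ∈ I), j i) (t i) =
      (-1) ^ ((k - 1) * (n - I.card)) * ∏ i ∈ Iᶜ, Q i k (t i) := by
    have hcard : Iᶜ.card = n - I.card := by rw [Finset.card_compl, Fintype.card_fin]
    rw [pow_mul, ← hcard, ← Finset.prod_const, ← Finset.prod_mul_distrib]
    refine Finset.prod_congr rfl fun i hi => ?_
    rw [Finset.mem_compl] at hi
    simp [emWeight, hi, hj i hi]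
  have h3 : ∏ i, (if i ∈ I then Ncoeff (q i) (lam i) (Q i) k
      else fun j => if j = 0 then 1 else 0) (j i) =
      ∏ i ∈ I, Ncoeff (q i) (lam i) (Q i) k (j i) := by
    rw [← Finset.prod_mul_prod_compl I, Finset.prod_congr rfl fun i (hi : i ∈ I) => by rw [if_pos hi],
      Finset.prod_eq_one (s := Iᶜ), mul_one]
    intro i hi
    rw [Finset.mem_compl] at hi
    simp [hi, hj i hi]
  have h4 : (-1 : ℂ) ^ (∑ i, (j i : ℕ)) = ∏ i ∈ I, (-1) ^ (j i : ℕ) := by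
    rw [← Finset.prod_pow_eq_pow_sum, ← Finset.prod_mul_prod_compl I,
      Finset.prod_eq_one (s := Iᶜ), mul_one]
    intro i hi
    rw [hj i (Finset.mem_compl.1 hi), pow_zero]
  rw [← Finset.prod_mul_prod_compl I, h1, h2, h3, h4]
  ring

/-- The twisted weighted Euler–Maclaurin formula for the standard orthant. -/
theorem sum_twisted_eq_opApply_add_orthantRemainder {n : ℕ} {q lam : Fin n → ℂ}
    (hn : ∀ i, ‖lam i‖ = 1) {Q : Fin n → ℕ → ℝ → ℂ} (hQ : ∀ i, IsQFamily (lam i) (Q i)) {k : ℕ}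
    (hk : 1 < k) {g : (Fin n → ℝ) → ℂ} (hg : ContDiff ℝ (n * k : ℕ) g)
    (hgc : HasCompactSupport g) {B : ℝ} {M : ℕ} (hB : B < M) (hgB : ∀ x i, B < x i → g x = 0) :
    ∑ m : Fin n → Fin (M + 1),
        (∏ i, if (m i : ℕ) = 0 then q i else lam i ^ (m i : ℕ)) * g (fun i => (m i : ℕ)) =
      opApply (fun i => Ncoeff (q i) (lam i) (Q i) k) k (fun h => ∫ t in stdOrthant n h, g t) +
        orthantRemainder q lam Q k g := by
  have hQc : ∀ i, Continuous (Q i k) := fun i => by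
    obtain ⟨a, b, hK, -⟩ := (hQ i).exists_isSummationKernel (hn i) (q i) hk
    have := hK.continuous (k - 2)
    rwa [Nat.sub_add_cancel hk] at this
  have hW : ∀ i s, Continuous (emWeight (q i) (lam i) (Q i) k s) := by
    intro i s
    unfold emWeight
    split_ifs
    · exact continuous_const
    · exact continuous_const.mul (hQc i)
    · exact continuous_const
  rw [sum_prod_mul_eq_sum_integral k (emOrder k) (emOrder_le k) B M
    (fun i m => if m = 0 then q i else lam i ^ m) (fun i => emWeight (q i) (lam i) (Q i) k) hW
    (fun i F hF hFB => sum_twisted_eq_sum_integral (hn i) (hQ i) (q i) hk hF hB hFB) hg hgc hgB,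
    sum_pi_prod_eq_sum_finset, opApply_add_orthantRemainder]
  refine Finset.sum_congr rfl fun I _ => ?_
  rw [opApply_eq_sum, Finset.mul_sum]
  refine Finset.sum_congr rfl fun j _ => ?_
  by_cases hj : ∀ i ∉ I, (j i : ℕ) = 0
  · have hsum : ∑ i, (j i : ℕ) + ∑ i, (if i ∈ I then 0 else k) ≤ n * k := by
      rw [← Finset.sum_add_distrib]
      calc ∑ i, ((j i : ℕ) + if i ∈ I then 0 else k) ≤ ∑ _i : Fin n, k := by
            refine Finset.sum_le_sum fun i _ => ?_
            split_ifs with hi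
            · simpa using Nat.lt_succ_iff.1 (j i).2
            · simp [hj i hi]
        _ = n * k := by simp
    rw [mixedPartial_setIntegral_stdOrthant Iᶜ hQc (fun i => (j i : ℕ))
      (fun i hi => hj i (Finset.mem_compl.1 hi))
      (contDiff_mixedPartial _ (hg.of_le (by exact_mod_cast hsum)))
      (hasCompactSupport_mixedPartial _ hgc),
      mixedPartial_mixedPartial _ _ (hg.of_le (by exact_mod_cast hsum)), Pi.smul_apply,
      smul_eq_mul, ← mul_assoc, ← mul_assoc, ← integral_const_mul]
    have ho : (fun i => emOrder k (decide (i ∈ I), j i)) =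
        (fun i => (j i : ℕ)) + fun i => if i ∈ I then 0 else k := by
      ext i
      by_cases hi : i ∈ I <;> simp [emOrder, hi, hj]
    simp_rw [prod_emWeight q lam Q k I j hj, ho, mul_assoc]
  · push Not at hj
    obtain ⟨i, hi, hji⟩ := hj
    have hW0 : ∀ t : Fin n → ℝ,
        ∏ i, emWeight (q i) (lam i) (Q i) k (decide (i ∈ I), j i) (t i) = 0 := fun t =>
      Finset.prod_eq_zero (Finset.mem_univ i) (by simp [emWeight, hi, hji])
    have hc0 : ∏ i, (if i ∈ I then Ncoeff (q i) (lam i) (Q i) k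
      else fun j => if j = 0 then 1 else 0) (j i) = 0 :=
      Finset.prod_eq_zero (Finset.mem_univ i) (by simp [hi, hji])
    simp_rw [hW0]
    rw [hc0]
    simp

section Lattice

variable {n : ℕ} {u : Fin n → Fin n → ℤ} {α : Fin n → Fin n → ℝ}

theorem dual_matrix_mul (hdual : ∀ i j, (∑ l, (u i l : ℝ) * α j l) = if i = j then 1 else 0) :
    ((Matrix.of u).map fun z : ℤ => (z : ℝ)) * (Matrix.of α).transpose = 1 := by
  ext i j
  rw [Matrix.mul_apply, Matrix.one_apply, ← hdual]
  rfl

theorem sum_dual_mul (hdual : ∀ i j, (∑ l, (u i l : ℝ) * α j l) = if i = j then 1 else 0)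
    (j l : Fin n) : ∑ i, α i j * (u i l : ℝ) = if j = l then 1 else 0 := by
  have h := congrArg (fun M => M j l) (mul_eq_one_comm.1 (dual_matrix_mul hdual))
  rw [Matrix.mul_apply, Matrix.one_apply] at h
  exact h

theorem card_quotient_span_eq (hu : LinearIndependent ℤ u) :
    Nat.card ((Fin n → ℤ) ⧸ Submodule.span ℤ (Set.range u)) = (Matrix.of u).det.natAbs := by
  rw [← Submodule.natAbs_det_basis_change (Pi.basisFun ℤ (Fin n)) _ (Module.Basis.span hu),
    Pi.basisFun_det]
  congr 2
  ext i j
  simp [Module.Basis.span_apply]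

theorem abs_det_dual_mul_card
    (hdual : ∀ i j, (∑ l, (u i l : ℝ) * α j l) = if i = j then 1 else 0) :
    |(Matrix.of α).transpose.det| *
      Nat.card ((Fin n → ℤ) ⧸ Submodule.span ℤ (Set.range u)) = 1 := by
  have h := congrArg Matrix.det (dual_matrix_mul hdual)
  have hc : ((Matrix.of u).map fun z : ℤ => (z : ℝ)).det = ((Matrix.of u).det : ℝ) :=
    ((Int.castRingHom ℝ).map_det (Matrix.of u)).symm
  rw [Matrix.det_mul, Matrix.det_one, hc] at h
  have hu : LinearIndependent ℤ u := by
    refine Matrix.linearIndependent_rows_of_det_ne_zero (A := Matrix.of u) fun h0 => ?_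
    rw [h0] at h
    simp at h
  rw [card_quotient_span_eq hu, Nat.cast_natAbs, Int.cast_abs, mul_comm, ← abs_mul, h, abs_one]

theorem lamOf_add (g g' : Fin n → ℤ) (i : Fin n) :
    lamOf α (g + g') i = lamOf α g i * lamOf α g' i := by
  rw [lamOf, lamOf, lamOf, ← Complex.exp_add]
  congr 1
  push_cast [Pi.add_apply]
  rw [← mul_add, ← Finset.sum_add_distrib]
  congr 2
  ext j
  ring

theorem lamOf_zero (i : Fin n) : lamOf α 0 i = 1 := by
  simp [lamOf]

/-- The characters `g ↦ e^{2πi⟨g,αᵢ⟩}` of the lattice. -/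
noncomputable def lamChar (α : Fin n → Fin n → ℝ) (i : Fin n) : AddChar (Fin n → ℤ) ℂ where
  toFun g := lamOf α g i
  map_zero_eq_one' := lamOf_zero i
  map_add_eq_mul' g g' := lamOf_add g g' i

theorem lamOf_eq_one_of_mem_span
    (hdual : ∀ i j, (∑ l, (u i l : ℝ) * α j l) = if i = j then 1 else 0) {g : Fin n → ℤ}
    (hg : g ∈ Submodule.span ℤ (Set.range u)) (i : Fin n) : lamOf α g i = 1 := by
  induction hg using Submodule.span_induction with
  | mem x hx =>
    obtain ⟨l, rfl⟩ := hx
    rw [lamOf, hdual]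
    split_ifs <;> simp
  | zero => exact lamOf_zero i
  | add x y _ _ hx hy => rw [lamOf_add, hx, hy, one_mul]
  | smul a x _ hx =>
    have : lamOf α (a • x) i = lamOf α x i ^ a := (lamChar α i).map_zsmul_eq_zpow a x
    rw [this, hx, one_zpow]

theorem lamOf_congr (hdual : ∀ i j, (∑ l, (u i l : ℝ) * α j l) = if i = j then 1 else 0)
    {g g' : Fin n → ℤ} (h : (Submodule.Quotient.mk g :
      (Fin n → ℤ) ⧸ Submodule.span ℤ (Set.range u)) = Submodule.Quotient.mk g') (i : Fin n) :
    lamOf α g i = lamOf α g' i := by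
  rw [Submodule.Quotient.eq] at h
  rw [← sub_add_cancel g g', lamOf_add, lamOf_eq_one_of_mem_span hdual h, one_mul]

theorem lamOf_pow_card (hdual : ∀ i j, (∑ l, (u i l : ℝ) * α j l) = if i = j then 1 else 0)
    (g : Fin n → ℤ) (i : Fin n) :
    lamOf α g i ^ Nat.card ((Fin n → ℤ) ⧸ Submodule.span ℤ (Set.range u)) = 1 := by
  have h : Nat.card ((Fin n → ℤ) ⧸ Submodule.span ℤ (Set.range u)) • g ∈
      Submodule.span ℤ (Set.range u) := by
    rw [← Submodule.Quotient.mk_eq_zero, Submodule.Quotient.mk_smul]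
    exact card_nsmul_eq_zero'
  have h2 : lamOf α (Nat.card ((Fin n → ℤ) ⧸ Submodule.span ℤ (Set.range u)) • g) i =
      lamOf α g i ^ Nat.card ((Fin n → ℤ) ⧸ Submodule.span ℤ (Set.range u)) :=
    (lamChar α i).map_nsmul_eq_pow _ g
  rw [← h2, lamOf_eq_one_of_mem_span hdual h]

theorem prod_lamOf_pow (g : Fin n → ℤ) (m : Fin n → ℕ) :
    ∏ i, lamOf α g i ^ m i =
      Complex.exp (2 * Real.pi * Complex.I * (∑ j, (g j : ℝ) * ∑ i, m i * α i j : ℝ)) := by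
  simp only [lamOf, ← Complex.exp_nat_mul]
  rw [← Complex.exp_sum]
  congr 1
  push_cast
  simp only [Finset.mul_sum]
  rw [Finset.sum_comm]
  refine Finset.sum_congr rfl fun j _ => Finset.sum_congr rfl fun i _ => ?_
  ring

/-- Orthogonality of characters: averaging over `Γ` detects the lattice points. -/
theorem sum_prod_lamOf_pow
    (hdual : ∀ i j, (∑ l, (u i l : ℝ) * α j l) = if i = j then 1 else 0)
    [Fintype ((Fin n → ℤ) ⧸ Submodule.span ℤ (Set.range u))]
    {s : ((Fin n → ℤ) ⧸ Submodule.span ℤ (Set.range u)) → Fin n → ℤ}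
    (hs : ∀ γ, Submodule.Quotient.mk (s γ) = γ) (v : Fin n → ℤ) (m : Fin n → ℕ) :
    ∑ γ, ∏ i, lamOf α (s γ) i ^ m i =
      if ∃ x : Fin n → ℤ, ∀ i, ∑ j, u i j * (x j - v j) = m i then
        (Nat.card ((Fin n → ℤ) ⧸ Submodule.span ℤ (Set.range u)) : ℂ) else 0 := by
  split_ifs with h
  · obtain ⟨x, hx⟩ := h
    have hy : ∀ j, ∑ i, (m i : ℝ) * α i j = ((x j - v j : ℤ) : ℝ) := by
      intro j
      have h1 : ∀ i, (m i : ℝ) = ∑ l, (u i l : ℝ) * ((x l - v l : ℤ) : ℝ) := by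
        intro i
        exact_mod_cast (hx i).symm
      simp only [h1, Finset.sum_mul]
      rw [Finset.sum_comm]
      calc ∑ l, ∑ i, (u i l : ℝ) * ((x l - v l : ℤ) : ℝ) * α i j
          = ∑ l, ((x l - v l : ℤ) : ℝ) * ∑ i, α i j * (u i l : ℝ) := by
            refine Finset.sum_congr rfl fun l _ => ?_
            rw [Finset.mul_sum]
            exact Finset.sum_congr rfl fun i _ => by ring
        _ = _ := by simp [sum_dual_mul hdual]
    have h1 : ∀ γ, ∏ i, lamOf α (s γ) i ^ m i = 1 := by
      intro γ
      rw [prod_lamOf_pow, Complex.exp_eq_one_iff]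
      refine ⟨∑ j, s γ j * (x j - v j), ?_⟩
      simp only [hy]
      push_cast
      ring
    simp [h1]
  · by_cases hall : ∀ l, ∏ i, lamOf α (Pi.single l 1) i ^ m i = 1
    · refine absurd ?_ h
      have hint : ∀ j, ∃ z : ℤ, ∑ i, (m i : ℝ) * α i j = z := by
        intro l
        have h1 := hall l
        rw [prod_lamOf_pow, Complex.exp_eq_one_iff] at h1
        obtain ⟨z, hz⟩ := h1
        refine ⟨z, ?_⟩
        rw [mul_comm (z : ℂ)] at hz
        have := mul_left_cancel₀ Complex.two_pi_I_ne_zero hz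
        have h2 : ∑ j, ((Pi.single l 1 : Fin n → ℤ) j : ℝ) * ∑ i, (m i : ℝ) * α i j = z := by
          exact_mod_cast this
        simpa [Pi.single_apply] using h2
      choose z hz using hint
      refine ⟨fun j => v j + z j, fun i => ?_⟩
      have h1 : ∑ j, (u i j : ℝ) * z j = m i := by
        simp only [← hz, Finset.mul_sum]
        rw [Finset.sum_comm]
        calc ∑ l, ∑ j, (u i j : ℝ) * ((m l : ℝ) * α l j)
            = ∑ l, (m l : ℝ) * ∑ j, (u i j : ℝ) * α l j := by
              refine Finset.sum_congr rfl fun l _ => ?_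
              rw [Finset.mul_sum]
              exact Finset.sum_congr rfl fun j _ => by ring
          _ = m i := by simp [hdual]
      simp only [add_sub_cancel_left]
      exact_mod_cast h1
    · push Not at hall
      obtain ⟨l, hl⟩ := hall
      have hshift : ∑ γ, ∏ i, lamOf α (s γ) i ^ m i =
          (∑ γ, ∏ i, lamOf α (s γ) i ^ m i) * ∏ i, lamOf α (Pi.single l 1) i ^ m i := by
        rw [Finset.sum_mul, ← Equiv.sum_comp (Equiv.addRight (Submodule.Quotient.mk
          (Pi.single l 1) : (Fin n → ℤ) ⧸ Submodule.span ℤ (Set.range u)))]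
        refine Finset.sum_congr rfl fun γ _ => ?_
        rw [← Finset.prod_mul_distrib]
        refine Finset.prod_congr rfl fun i _ => ?_
        rw [← mul_pow, ← lamOf_add]
        congr 1
        refine lamOf_congr hdual ?_ i
        rw [hs, Submodule.Quotient.mk_add, hs]
        rfl
      have : (∑ γ, ∏ i, lamOf α (s γ) i ^ m i) *
          (∏ i, lamOf α (Pi.single l 1) i ^ m i - 1) = 0 := by
        rw [mul_sub, ← hshift, mul_one, sub_self]
      exact (mul_eq_zero.1 this).resolve_right (sub_ne_zero.2 hl)

end Lattice

section Final

variable {n : ℕ} {u : Fin n → Fin n → ℤ} {α : Fin n → Fin n → ℝ}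

theorem sum_mul_dual_combination
    (hdual : ∀ i j, (∑ l, (u i l : ℝ) * α j l) = if i = j then 1 else 0)
    (v : Fin n → ℤ) (t : Fin n → ℝ) (i : Fin n) :
    ∑ j, (u i j : ℝ) * ((v j : ℝ) + ∑ l, t l * α l j - v j) = t i := by
  simp only [add_sub_cancel_left, Finset.mul_sum]
  rw [Finset.sum_comm]
  calc ∑ l, ∑ j, (u i j : ℝ) * (t l * α l j)
      = ∑ l, t l * ∑ j, (u i j : ℝ) * α l j := by
        refine Finset.sum_congr rfl fun l _ => ?_
        rw [Finset.mul_sum]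
        exact Finset.sum_congr rfl fun j _ => by ring
    _ = t i := by simp [hdual]

theorem dual_combination_sum_mul
    (hdual : ∀ i j, (∑ l, (u i l : ℝ) * α j l) = if i = j then 1 else 0)
    (v : Fin n → ℤ) (x : Fin n → ℝ) (j : Fin n) :
    (v j : ℝ) + ∑ i, (∑ l, (u i l : ℝ) * (x l - v l)) * α i j = x j := by
  simp only [Finset.sum_mul]
  rw [Finset.sum_comm]
  calc (v j : ℝ) + ∑ l, ∑ i, (u i l : ℝ) * (x l - v l) * α i j
      = v j + ∑ l, (x l - v l) * ∑ i, α i j * (u i l : ℝ) := by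
        congr 1
        refine Finset.sum_congr rfl fun l _ => ?_
        rw [Finset.mul_sum]
        exact Finset.sum_congr rfl fun i _ => by ring
    _ = x j := by simp [sum_dual_mul hdual]

/-- Change of variables from the cone to the standard orthant. -/
theorem setIntegral_cone_eq
    (hdual : ∀ i j, (∑ l, (u i l : ℝ) * α j l) = if i = j then 1 else 0)
    (v : Fin n → ℤ) (f : (Fin n → ℝ) → ℂ) (h : Fin n → ℝ) :
    ∫ x in {x : Fin n → ℝ | ∀ i, 0 ≤ (∑ j, (u i j : ℝ) * (x j - (v j : ℝ))) + h i}, f x =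
      (1 / (Nat.card ((Fin n → ℤ) ⧸ Submodule.span ℤ (Set.range u)) : ℂ)) *
        ∫ t in stdOrthant n h, f (fun j => (v j : ℝ) + ∑ i, t i * α i j) := by
  have himg : {x : Fin n → ℝ | ∀ i, 0 ≤ (∑ j, (u i j : ℝ) * (x j - (v j : ℝ))) + h i} =
      (fun (t : Fin n → ℝ) j => (v j : ℝ) + ∑ i, t i * α i j) '' stdOrthant n h := by
    ext x
    constructor
    · intro hx
      refine ⟨fun i => ∑ l, (u i l : ℝ) * (x l - v l), fun i => ?_, ?_⟩
      · have := hx i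
        linarith
      · ext j
        exact dual_combination_sum_mul hdual v x j
    · rintro ⟨t, ht, rfl⟩ i
      rw [sum_mul_dual_combination hdual]
      have := ht i
      linarith
  have hderiv : ∀ t : Fin n → ℝ, HasFDerivAt
      (fun (t : Fin n → ℝ) j => (v j : ℝ) + ∑ i, t i * α i j)
      (LinearMap.toContinuousLinearMap (Matrix.toLin' (Matrix.of α).transpose)) t := by
    intro t
    have h1 : (fun (t : Fin n → ℝ) j => (v j : ℝ) + ∑ i, t i * α i j) = fun t =>
        (fun j => (v j : ℝ)) +
          LinearMap.toContinuousLinearMap (Matrix.toLin' (Matrix.of α).transpose) t := by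
      ext t j
      simp [Matrix.mulVec, dotProduct, mul_comm]
    rw [h1]
    exact (ContinuousLinearMap.hasFDerivAt _).const_add _
  have hinj : Set.InjOn (fun (t : Fin n → ℝ) j => (v j : ℝ) + ∑ i, t i * α i j)
      (stdOrthant n h) := by
    intro t _ t' _ htt
    ext i
    rw [← sum_mul_dual_combination hdual v t i, ← sum_mul_dual_combination hdual v t' i]
    exact Finset.sum_congr rfl fun j _ => congrArg (fun y => (u i j : ℝ) * (y - v j)) (congrFun htt j)
  have hdet := abs_det_dual_mul_card hdual
  have hc : (Nat.card ((Fin n → ℤ) ⧸ Submodule.span ℤ (Set.range u)) : ℝ) ≠ 0 :=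
    right_ne_zero_of_mul_eq_one hdet
  rw [himg, integral_image_eq_integral_abs_det_fderiv_smul volume (measurableSet_stdOrthant n h)
    (fun t _ => (hderiv t).hasFDerivWithinAt) hinj, integral_smul, ContinuousLinearMap.det,
    LinearMap.coe_toContinuousLinearMap, LinearMap.det_toLin', eq_div_of_mul_eq hc hdet,
    Complex.real_smul]
  push_cast
  rfl

/-- The weighted lattice sum over a cone in the coordinates of the standard orthant. -/
theorem tsum_cone_eq (hdual : ∀ i j, (∑ l, (u i l : ℝ) * α j l) = if i = j then 1 else 0)
    (v : Fin n → ℤ) (q : Fin n → ℂ) {f g : (Fin n → ℝ) → ℂ}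
    (hg : g = fun t => f fun j => (v j : ℝ) + ∑ i, t i * α i j) {M : ℕ}
    (hgM : ∀ x i, (M : ℝ) < x i → g x = 0) :
    (∑' x : Fin n → ℤ,
        (if ∀ i, 0 ≤ ∑ j, u i j * (x j - v j) then
          (∏ i, if (∑ j, u i j * (x j - v j)) = 0 then q i else 1) else 0) *
          f (fun j => (x j : ℝ))) =
      ∑ m : Fin n → Fin (M + 1), (∏ i, if (m i : ℕ) = 0 then q i else 1) *
        (if ∃ x : Fin n → ℤ, ∀ i, ∑ j, u i j * (x j - v j) = (m i : ℕ) then 1 else 0) *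
          g (fun i => (m i : ℕ)) := by
  set T : (Fin n → ℤ) → Fin n → ℤ := fun x i => ∑ j, u i j * (x j - v j) with hT
  have hLT : ∀ x : Fin n → ℤ, (fun j => (v j : ℝ) + ∑ i, (T x i : ℝ) * α i j) =
      fun j => (x j : ℝ) := by
    intro x
    ext j
    rw [← dual_combination_sum_mul hdual v (fun j => (x j : ℝ)) j]
    push_cast [hT]
    rfl
  have hTinj : Function.Injective T := by
    intro x y hxy
    ext j
    have := congrFun ((hLT x).symm.trans (hxy ▸ hLT y)) j
    exact_mod_cast this
  set Φ : (Fin n → ℤ) → ℂ := fun z =>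
    (if ∀ i, 0 ≤ z i then ∏ i, (if z i = 0 then q i else 1) else 0) *
      (if ∃ x, T x = z then 1 else 0) * g fun i => (z i : ℝ) with hΦ
  have h1 : ∀ x : Fin n → ℤ, (if ∀ i, 0 ≤ ∑ j, u i j * (x j - v j) then
          (∏ i, if (∑ j, u i j * (x j - v j)) = 0 then q i else 1) else 0) *
          f (fun j => (x j : ℝ)) = Φ (T x) := by
    intro x
    simp only [hΦ]
    rw [if_pos (⟨x, rfl⟩ : ∃ y, T y = T x), mul_one, hg]
    simp only [hLT]
    rfl
  simp only [h1]
  rw [hTinj.tsum_eq]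
  · have hbox : Function.Injective
        fun (m : Fin n → Fin (M + 1)) (i : Fin n) => ((m i : ℕ) : ℤ) := by
      intro m m' h
      ext i
      have hi : ((m i : ℕ) : ℤ) = (m' i : ℕ) := congrFun h i
      exact_mod_cast hi
    rw [← hbox.tsum_eq, tsum_fintype]
    · refine Finset.sum_congr rfl fun m _ => ?_
      simp [hΦ, hT, funext_iff]
    · intro z hz
      have hz1 : ∀ i, 0 ≤ z i := by
        by_contra hc
        exact hz (by simp [hΦ, hc])
      have hz2 : ∀ i, z i ≤ M := by
        by_contra! hc
        obtain ⟨i, hi⟩ := hc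
        refine hz ?_
        simp only [hΦ]
        rw [hgM _ i (by exact_mod_cast hi), mul_zero]
      refine ⟨fun i => ⟨(z i).toNat, by have := hz1 i; have := hz2 i; omega⟩, ?_⟩
      ext i
      simpa using hz1 i
  · intro z hz
    by_contra hc
    exact hz (by simp only [hΦ]; rw [if_neg (show ¬ ∃ x, T x = z from hc)]; simp)

end Final

/-- **Weighted Euler–Maclaurin with remainder for a simple integral orthant.**
Let `v ∈ ℤⁿ`, `u₁,…,uₙ ∈ ℤⁿ` linearly independent primitive lattice vectors with dual
basis `α₁,…,αₙ`, and let `C = {x : ⟨uᵢ,x-v⟩ ≥ 0 ∀i}`.  Let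
`Γ = ℤⁿ/(ℤu₁+⋯+ℤuₙ)`, with section `s` of the quotient map, and
`λ_{γ,i} = e^{2πi⟨γ,αᵢ⟩}`.  Then `Γ` is finite, `λ_{γ,i}` is well defined and is a root
of unity, and for `q ∈ ℂⁿ`, `k > 1` and `f : ℝⁿ → ℂ` compactly supported of class
`C^{nk}`,
`∑_{x ∈ C∩ℤⁿ} (∏_{i:⟨uᵢ,x-v⟩=0} qᵢ) f(x)
  = ∑_{γ∈Γ} [∏ᵢ N_{qᵢ}^{k,λ_{γ,i}}(∂/∂hᵢ)] ∫_{C(h)} f |_{h=0} + R^C_{q,k}(f)`,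
with `R^C_{q,k}(f) = (1/|Γ|) ∑_{γ∈Γ} R^{st}_{q,k}(λ_{γ,1},…,λ_{γ,n}; f∘L)`,
`L(t) = v + ∑ tᵢαᵢ`. -/
theorem weighted_euler_maclaurin_simple_orthant
    (n : ℕ) (v : Fin n → ℤ) (u : Fin n → Fin n → ℤ) (α : Fin n → Fin n → ℝ)
    (hprim : ∀ i, ¬∃ m : ℤ, 1 < m ∧ ∃ w : Fin n → ℤ, ∀ j, u i j = m * w j)
    (hindep : LinearIndependent ℝ (fun i => fun j => (u i j : ℝ)))
    (hdual : ∀ i j, (∑ l, (u i l : ℝ) * α j l) = if i = j then 1 else 0)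
    (q : Fin n → ℂ) (k : ℕ) (hk : 1 < k)
    (f : (Fin n → ℝ) → ℂ) (hf : ContDiff ℝ (n * k : ℕ) f)
    (hfsupp : HasCompactSupport f)
    (s : ((Fin n → ℤ) ⧸ Submodule.span ℤ (Set.range u)) → Fin n → ℤ)
    (hs : ∀ γ, Submodule.Quotient.mk (s γ) = γ)
    (Q : ((Fin n → ℤ) ⧸ Submodule.span ℤ (Set.range u)) → Fin n → ℕ → ℝ → ℂ)
    (hQ : ∀ γ i, IsQFamily (lamOf α (s γ) i) (Q γ i)) :
    Finite ((Fin n → ℤ) ⧸ Submodule.span ℤ (Set.range u)) ∧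
    (∀ g g' : Fin n → ℤ,
      (Submodule.Quotient.mk g : (Fin n → ℤ) ⧸ Submodule.span ℤ (Set.range u)) =
        Submodule.Quotient.mk g' → ∀ i, lamOf α g i = lamOf α g' i) ∧
    (∀ γ i, ∃ N : ℕ, 0 < N ∧ lamOf α (s γ) i ^ N = 1) ∧
    (∑' x : Fin n → ℤ,
        (if ∀ i, 0 ≤ ∑ j, u i j * (x j - v j) then
          (∏ i, if (∑ j, u i j * (x j - v j)) = 0 then q i else 1) else 0) *
          f (fun j => (x j : ℝ))) =
      (∑ᶠ γ : (Fin n → ℤ) ⧸ Submodule.span ℤ (Set.range u),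
        opApply (fun i => Ncoeff (q i) (lamOf α (s γ) i) (Q γ i) k) k
          (fun h => ∫ x in {x : Fin n → ℝ |
            ∀ i, 0 ≤ (∑ j, (u i j : ℝ) * (x j - (v j : ℝ))) + h i}, f x))
      + (1 / (Nat.card ((Fin n → ℤ) ⧸ Submodule.span ℤ (Set.range u)) : ℂ)) *
          ∑ᶠ γ : (Fin n → ℤ) ⧸ Submodule.span ℤ (Set.range u),
            orthantRemainder q (fun i => lamOf α (s γ) i) (Q γ) k
              (fun t => f (fun j => (v j : ℝ) + ∑ i, t i * α i j)) := by
  have hdet := abs_det_dual_mul_card hdual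
  have hcR : (Nat.card ((Fin n → ℤ) ⧸ Submodule.span ℤ (Set.range u)) : ℝ) ≠ 0 :=
    right_ne_zero_of_mul_eq_one hdet
  have hc : Nat.card ((Fin n → ℤ) ⧸ Submodule.span ℤ (Set.range u)) ≠ 0 := by
    exact_mod_cast hcR
  have hfin : Finite ((Fin n → ℤ) ⧸ Submodule.span ℤ (Set.range u)) :=
    Nat.finite_of_card_ne_zero hc
  refine ⟨hfin, fun g g' h i => lamOf_congr hdual h i, fun γ i =>
    ⟨_, Nat.pos_of_ne_zero hc, lamOf_pow_card hdual (s γ) i⟩, ?_⟩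
  have hfint := Fintype.ofFinite ((Fin n → ℤ) ⧸ Submodule.span ℤ (Set.range u))
  rw [finsum_eq_sum_of_fintype, finsum_eq_sum_of_fintype]
  set g : (Fin n → ℝ) → ℂ := fun t => f fun j => (v j : ℝ) + ∑ i, t i * α i j with hg
  have hgC : ContDiff ℝ (n * k : ℕ) g := hf.comp (by fun_prop)
  have hgc : HasCompactSupport g := by
    have hT : Continuous fun (x : Fin n → ℝ) (i : Fin n) =>
        ∑ j, (u i j : ℝ) * (x j - (v j : ℝ)) := by fun_prop
    refine HasCompactSupport.intro (hfsupp.isCompact.image hT) fun t ht => ?_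
    by_contra hne
    refine ht ⟨_, subset_tsupport f hne, ?_⟩
    ext i
    exact sum_mul_dual_combination hdual v t i
  obtain ⟨B, hB⟩ := hgc.isCompact.isBounded.exists_norm_le
  obtain ⟨M, hM⟩ := exists_nat_gt B
  have hgB : ∀ x i, B < x i → g x = 0 := by
    intro x i hx
    by_contra hne
    have h1 := hB x (subset_tsupport g hne)
    have h2 := norm_le_pi_norm x i
    have h3 := Real.le_norm_self (x i)
    linarith
  rw [tsum_cone_eq hdual v q hg fun x i hx => hgB x i (hM.trans hx)]
  have hmain : ∀ γ, opApply (fun i => Ncoeff (q i) (lamOf α (s γ) i) (Q γ i) k) k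
      (fun h => ∫ x in {x : Fin n → ℝ |
        ∀ i, 0 ≤ (∑ j, (u i j : ℝ) * (x j - (v j : ℝ))) + h i}, f x) =
      (1 / (Nat.card ((Fin n → ℤ) ⧸ Submodule.span ℤ (Set.range u)) : ℂ)) *
        opApply (fun i => Ncoeff (q i) (lamOf α (s γ) i) (Q γ i) k) k
          (fun h => ∫ t in stdOrthant n h, g t) := by
    intro γ
    rw [← opApply_const_smul]
    congr 1
    ext h
    exact setIntegral_cone_eq hdual v f h
  simp only [hmain]
  rw [← Finset.mul_sum, ← mul_add, ← Finset.sum_add_distrib]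
  have hem := fun γ => sum_twisted_eq_opApply_add_orthantRemainder (q := q)
    (fun i => Complex.norm_eq_one_of_pow_eq_one (lamOf_pow_card hdual (s γ) i) hc) (hQ γ) hk
    hgC hgc hM hgB
  simp only [← hem]
  have hcC : (Nat.card ((Fin n → ℤ) ⧸ Submodule.span ℤ (Set.range u)) : ℂ) ≠ 0 := by
    exact_mod_cast hc
  rw [Finset.sum_comm, Finset.mul_sum]
  refine Finset.sum_congr rfl fun m _ => ?_
  have hw : ∀ γ, ∏ i, (if (m i : ℕ) = 0 then q i else lamOf α (s γ) i ^ (m i : ℕ)) =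
      (∏ i, if (m i : ℕ) = 0 then q i else 1) * ∏ i, lamOf α (s γ) i ^ (m i : ℕ) := by
    intro γ
    rw [← Finset.prod_mul_distrib]
    refine Finset.prod_congr rfl fun i _ => ?_
    split_ifs with h0 <;> simp [h0]
  simp only [hw]
  rw [← Finset.sum_mul, ← Finset.mul_sum, sum_prod_lamOf_pow hdual hs v fun i => (m i : ℕ)]
  split_ifs
  · field_simp
  · simp
end

section
/- Weighted polar decomposition of a simple integral polytope: Let Δ ⊂ ℝ^n be a simple integral polytope with facet normals u_1,…,u_d and facet constants μ_1,…,μ_d, let q ∈ ℂ, and let ξ be a polarizing vector for Δ. Then for every compactly supported function f : ℝ^n → ℂ, Σ_{x ∈ Δ ∩ ℤ^n} q^{c(x)} f(x) = Σ_v (−1)^{#v} Σ_{x ∈ C_v^♯ ∩ ℤ^n} w_v^♯(x) f(x), where the outer sum on the right runs over the vertices v of Δ. -/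
open scoped BigOperators Classical

/-- The standard pairing `⟨w, x⟩ = ∑ j, w j * x j` between an integer vector and a
real vector. -/
def intPair {n : ℕ} (w : Fin n → ℤ) (x : Fin n → ℝ) : ℝ := ∑ j, (w j : ℝ) * x j

namespace SimplePolytope

variable {n d : ℕ}

/-- The polyhedron `{x | ∀ i, 0 ≤ ⟨U i, x⟩ + μ i}`. -/
def body (U : Fin d → Fin n → ℝ) (μ : Fin d → ℝ) : Set (Fin n → ℝ) :=
  {x | ∀ i, 0 ≤ U i ⬝ᵥ x + μ i}

/-- The indices of the constraints that are tight at `x`. -/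
noncomputable def tight (U : Fin d → Fin n → ℝ) (μ : Fin d → ℝ) (x : Fin n → ℝ) :
    Finset (Fin d) :=
  Finset.univ.filter fun i => U i ⬝ᵥ x + μ i = 0

lemma mem_tight {U : Fin d → Fin n → ℝ} {μ : Fin d → ℝ} {x : Fin n → ℝ} {i : Fin d} :
    i ∈ tight U μ x ↔ U i ⬝ᵥ x + μ i = 0 := by
  simp [tight]

/-- A compact simple polyhedron with vertex set `V` and edge vectors `A v i`. -/
structure IsSimple (U : Fin d → Fin n → ℝ) (μ : Fin d → ℝ) (V : Finset (Fin n → ℝ))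
    (A : (Fin n → ℝ) → Fin d → (Fin n → ℝ)) : Prop where
  isCompact : IsCompact (body U μ)
  coe_vertices : (V : Set (Fin n → ℝ)) = Set.extremePoints ℝ (body U μ)
  card_tight : ∀ v ∈ V, (tight U μ v).card = n
  linearIndependent : ∀ v ∈ V,
    LinearIndependent ℝ (fun i : {i : Fin d // U i ⬝ᵥ v + μ i = 0} => U i.1)
  dual : ∀ v ∈ V, ∀ i ∈ tight U μ v, ∀ i' ∈ tight U μ v,
    U i' ⬝ᵥ A v i = if i' = i then 1 else 0

/-- `ξ` is not orthogonal to any edge. -/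
def IsPolarizing (U : Fin d → Fin n → ℝ) (μ : Fin d → ℝ) (V : Finset (Fin n → ℝ))
    (A : (Fin n → ℝ) → Fin d → (Fin n → ℝ)) (ξ : Fin n → ℝ) : Prop :=
  ∀ v ∈ V, ∀ i ∈ tight U μ v, ξ ⬝ᵥ A v i ≠ 0

/-- The weighted indicator of the closed half-line `0 ≤ t`. -/
noncomputable def halfLineWeight (q : ℂ) (t : ℝ) : ℂ :=
  if 0 < t then 1 else if t = 0 then q else 0

/-- The signed weighted indicator of the polarized tangent cone at `v`. -/
noncomputable def coneWeight (U : Fin d → Fin n → ℝ) (μ : Fin d → ℝ)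
    (A : (Fin n → ℝ) → Fin d → (Fin n → ℝ)) (g : Fin d → ℂ) (ξ v : Fin n → ℝ) : ℂ :=
  ∏ i ∈ tight U μ v, if 0 < ξ ⬝ᵥ A v i then g i - 1 else g i

variable {U : Fin d → Fin n → ℝ} {μ : Fin d → ℝ} {V : Finset (Fin n → ℝ)}
  {A : (Fin n → ℝ) → Fin d → (Fin n → ℝ)} {ξ v : Fin n → ℝ}

namespace IsSimple

lemma mem_body (h : IsSimple U μ V A) (hv : v ∈ V) : v ∈ body U μ := by
  have : v ∈ (V : Set (Fin n → ℝ)) := hv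
  rw [h.coe_vertices] at this
  exact this.1

lemma eq_zero_of_dotProduct_eq_zero (h : IsSimple U μ V A) (hv : v ∈ V) {z : Fin n → ℝ}
    (hz : ∀ i ∈ tight U μ v, U i ⬝ᵥ z = 0) : z = 0 := by
  have hspan := (h.linearIndependent v hv).span_eq_top_of_card_eq_finrank' (by
    rw [Fintype.card_subtype, Module.finrank_fin_fun]
    exact h.card_tight v hv)
  have key : ∀ w : Fin n → ℝ, w ⬝ᵥ z = 0 := by
    intro w
    have hw : w ∈ Submodule.span ℝ
        (Set.range fun i : {i : Fin d // U i ⬝ᵥ v + μ i = 0} => U i.1) := by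
      rw [hspan]; trivial
    induction hw using Submodule.span_induction with
    | mem w hw =>
      obtain ⟨i, rfl⟩ := hw
      exact hz i.1 (mem_tight.2 i.2)
    | zero => simp
    | add a b _ _ ha hb => rw [add_dotProduct, ha, hb, add_zero]
    | smul c a _ ha => rw [smul_dotProduct, ha, smul_zero]
  exact dotProduct_self_eq_zero.1 (key z)

lemma sub_eq_sum (h : IsSimple U μ V A) (hv : v ∈ V) (y : Fin n → ℝ) :
    y - v = ∑ i ∈ tight U μ v, (U i ⬝ᵥ y + μ i) • A v i := by
  rw [← sub_eq_zero]
  refine h.eq_zero_of_dotProduct_eq_zero hv fun i hi => ?_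
  have h1 : ∑ j ∈ tight U μ v, (U j ⬝ᵥ y + μ j) * (U i ⬝ᵥ A v j) = U i ⬝ᵥ y + μ i := by
    rw [Finset.sum_eq_single_of_mem i hi]
    · rw [h.dual v hv i hi i hi]; simp
    · intro j hj hji
      rw [h.dual v hv j hj i hi, if_neg (Ne.symm hji), mul_zero]
  have h2 := mem_tight.1 hi
  simp only [dotProduct_sub, dotProduct_sum, dotProduct_smul, smul_eq_mul, h1]
  linarith

lemma dotProduct_sub_eq_sum (h : IsSimple U μ V A) (hv : v ∈ V) (ξ y : Fin n → ℝ) :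
    ξ ⬝ᵥ y - ξ ⬝ᵥ v = ∑ i ∈ tight U μ v, (U i ⬝ᵥ y + μ i) * (ξ ⬝ᵥ A v i) := by
  rw [← dotProduct_sub, h.sub_eq_sum hv y, dotProduct_sum]
  simp [dotProduct_smul]

lemma eq_of_tight_subset (h : IsSimple U μ V A) (hv : v ∈ V) {y : Fin n → ℝ}
    (hy : tight U μ v ⊆ tight U μ y) : y = v := by
  rw [← sub_eq_zero, h.sub_eq_sum hv y]
  exact Finset.sum_eq_zero fun i hi => by rw [mem_tight.1 (hy hi), zero_smul]

/-- A linear functional attains its minimum over a nonempty face at a vertex. -/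
lemma exists_vertex_minimizing (h : IsSimple U μ V A) (ξ : Fin n → ℝ) (J : Finset (Fin d))
    {y : Fin n → ℝ} (hy : y ∈ body U μ) (hJ : J ⊆ tight U μ y) :
    ∃ v ∈ V, J ⊆ tight U μ v ∧
      ∀ z ∈ body U μ, J ⊆ tight U μ z → ξ ⬝ᵥ v ≤ ξ ⬝ᵥ z := by
  have hcont : ∀ w : Fin n → ℝ, Continuous fun x : Fin n → ℝ => w ⬝ᵥ x := fun w => by
    fun_prop
  set F : Set (Fin n → ℝ) := body U μ ∩ {z | J ⊆ tight U μ z} with hF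
  have hFclosed : IsClosed {z | J ⊆ tight U μ z} := by
    have : {z | J ⊆ tight U μ z} = ⋂ i ∈ J, {z | U i ⬝ᵥ z + μ i = 0} := by
      ext z
      simp [Finset.subset_iff, mem_tight]
    rw [this]
    exact isClosed_biInter fun i _ =>
      isClosed_eq ((hcont _).add continuous_const) continuous_const
  have hFc : IsCompact F := h.isCompact.inter_right hFclosed
  obtain ⟨m, hmF, hm⟩ := hFc.exists_isMinOn ⟨y, hy, hJ⟩ (hcont ξ).continuousOn
  have hmin : ∀ z ∈ F, ξ ⬝ᵥ m ≤ ξ ⬝ᵥ z := fun z hz => hm hz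
  have hGc : IsCompact (F ∩ {z | ξ ⬝ᵥ z ≤ ξ ⬝ᵥ m}) :=
    hFc.inter_right (isClosed_le (hcont ξ) continuous_const)
  obtain ⟨v, hv⟩ := hGc.extremePoints_nonempty ⟨m, hmF, le_refl (ξ ⬝ᵥ m)⟩
  have hext : IsExtreme ℝ (body U μ) (F ∩ {z | ξ ⬝ᵥ z ≤ ξ ⬝ᵥ m}) := by
    refine ⟨fun z hz => hz.1.1, ?_⟩
    rintro a ha b hb z ⟨⟨-, hzJ⟩, hzm⟩ ⟨s, t, hs, ht, hst, rfl⟩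
    have haJ : ∀ i ∈ J, U i ⬝ᵥ a + μ i = 0 ∧ U i ⬝ᵥ b + μ i = 0 := by
      intro i hi
      have h0 := mem_tight.1 (hzJ hi)
      simp only [dotProduct_add, dotProduct_smul, smul_eq_mul] at h0
      have h1 : s * (U i ⬝ᵥ a + μ i) + t * (U i ⬝ᵥ b + μ i) = 0 := by
        linear_combination h0 + μ i * hst
      have h2 := mul_nonneg hs.le (ha i)
      have h3 := mul_nonneg ht.le (hb i)
      refine ⟨?_, ?_⟩
      · exact (mul_eq_zero.1 (le_antisymm (by linarith) h2)).resolve_left hs.ne'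
      · exact (mul_eq_zero.1 (le_antisymm (by linarith) h3)).resolve_left ht.ne'
    have haF : a ∈ F := ⟨ha, fun i hi => mem_tight.2 (haJ i hi).1⟩
    have hbF : b ∈ F := ⟨hb, fun i hi => mem_tight.2 (haJ i hi).2⟩
    refine ⟨haF, ?_⟩
    have h1 := hmin b hbF
    simp only [Set.mem_ofPred_eq, dotProduct_add, dotProduct_smul, smul_eq_mul] at hzm ⊢
    have h2 := mul_le_mul_of_nonneg_left h1 ht.le
    have h3 : s * (ξ ⬝ᵥ a) ≤ s * (ξ ⬝ᵥ m) := by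
      have h4 : (s + t) * (ξ ⬝ᵥ m) = ξ ⬝ᵥ m := by rw [hst, one_mul]
      linarith [add_mul s t (ξ ⬝ᵥ m)]
    exact le_of_mul_le_mul_left h3 hs
  have hvV : v ∈ (V : Set (Fin n → ℝ)) := by
    rw [h.coe_vertices]
    exact hext.extremePoints_subset_extremePoints hv
  have hvG := hv.1
  exact ⟨v, hvV, hvG.1.2, fun z hz hzJ => le_trans hvG.2 (hmin z ⟨hz, hzJ⟩)⟩

lemma exists_pos_on_edges (h : IsSimple U μ V A) (hξ : IsPolarizing U μ V A ξ)
    (J : Finset (Fin d)) {y : Fin n → ℝ} (hy : y ∈ body U μ) (hJ : J ⊆ tight U μ y) :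
    ∃ v ∈ V, J ⊆ tight U μ v ∧ ∀ i ∈ tight U μ v \ J, 0 < ξ ⬝ᵥ A v i := by
  obtain ⟨v, hv, hJv, hmin⟩ := h.exists_vertex_minimizing ξ J hy hJ
  refine ⟨v, hv, hJv, fun i hi => ?_⟩
  obtain ⟨hiv, hiJ⟩ := Finset.mem_sdiff.1 hi
  have hloc : ∀ᶠ t : ℝ in nhdsWithin 0 (Set.Ioi 0), v + t • A v i ∈ body U μ := by
    have : ∀ k, ∀ᶠ t : ℝ in nhdsWithin 0 (Set.Ioi 0), 0 ≤ U k ⬝ᵥ (v + t • A v i) + μ k := by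
      intro k
      by_cases hk : k ∈ tight U μ v
      · filter_upwards [self_mem_nhdsWithin] with t ht
        have ht' : 0 < t := ht
        have h0 := mem_tight.1 hk
        rw [dotProduct_add, dotProduct_smul, h.dual v hv i hiv k hk, smul_eq_mul]
        split_ifs <;> linarith
      · have hpos : 0 < U k ⬝ᵥ v + μ k :=
          lt_of_le_of_ne (h.mem_body hv k) fun h0 => hk (mem_tight.2 h0.symm)
        have hc : Continuous fun t : ℝ => U k ⬝ᵥ (v + t • A v i) + μ k := by fun_prop
        have hc0 := hc.tendsto 0
        simp only [zero_smul, add_zero] at hc0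
        filter_upwards [nhdsWithin_le_nhds (hc0.eventually_const_lt hpos)] with t ht
        exact ht.le
    exact (Filter.eventually_all.2 this)
  obtain ⟨t, ht, ht0⟩ := (hloc.and self_mem_nhdsWithin).exists
  have ht0' : (0 : ℝ) < t := ht0
  have hle := hmin _ ht fun k hk => by
    have hkv := hJv hk
    have hki : k ≠ i := fun e => hiJ (e ▸ hk)
    rw [mem_tight, dotProduct_add, dotProduct_smul, h.dual v hv i hiv k hkv, if_neg hki,
      smul_zero, add_zero]
    exact mem_tight.1 hkv
  rw [dotProduct_add, dotProduct_smul, smul_eq_mul] at hle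
  have h1 : 0 ≤ ξ ⬝ᵥ A v i := nonneg_of_mul_nonneg_right (by linarith) ht0'
  exact lt_of_le_of_ne h1 (hξ v hv i hiv).symm

lemma eq_of_pos_on_edges (h : IsSimple U μ V A) {J : Finset (Fin d)} {v w : Fin n → ℝ}
    (hv : v ∈ V) (hw : w ∈ V) (hJv : J ⊆ tight U μ v) (hJw : J ⊆ tight U μ w)
    (hvξ : ∀ i ∈ tight U μ v \ J, 0 < ξ ⬝ᵥ A v i)
    (hwξ : ∀ i ∈ tight U μ w \ J, 0 < ξ ⬝ᵥ A w i) : w = v := by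
  have term : ∀ {v w : Fin n → ℝ}, w ∈ V → J ⊆ tight U μ w →
      (∀ i ∈ tight U μ v \ J, 0 < ξ ⬝ᵥ A v i) →
      ∀ i ∈ tight U μ v, 0 ≤ (U i ⬝ᵥ w + μ i) * (ξ ⬝ᵥ A v i) := by
    intro v w hw hJw hvξ i hi
    by_cases hiJ : i ∈ J
    · rw [mem_tight.1 (hJw hiJ), zero_mul]
    · exact mul_nonneg (h.mem_body hw i) (hvξ i (Finset.mem_sdiff.2 ⟨hi, hiJ⟩)).le
  have h1 := Finset.sum_nonneg (term hv hJv hwξ)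
  rw [← h.dotProduct_sub_eq_sum hw] at h1
  have h2 := Finset.sum_nonneg (term hw hJw hvξ)
  have h3 := h.dotProduct_sub_eq_sum hv ξ w
  have h4 := (Finset.sum_eq_zero_iff_of_nonneg (term hw hJw hvξ)).1 (by linarith)
  refine h.eq_of_tight_subset hv fun i hi => ?_
  by_cases hiJ : i ∈ J
  · exact hJw hiJ
  · exact mem_tight.2 ((mul_eq_zero.1 (h4 i hi)).resolve_right
      (hvξ i (Finset.mem_sdiff.2 ⟨hi, hiJ⟩)).ne')

/-- The sum over vertices is a sum over faces, indexed by the sets of facets containing them;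
in particular it does not depend on the polarizing vector. -/
lemma sum_coneWeight_eq_sum_faces (h : IsSimple U μ V A) (hξ : IsPolarizing U μ V A ξ)
    (g : Fin d → ℂ) :
    ∑ v ∈ V, coneWeight U μ A g ξ v =
      ∑ J : Finset (Fin d), if ∃ v ∈ V, J ⊆ tight U μ v then
        (∏ i ∈ J, g i) * (-1) ^ (n - J.card) else 0 := by
  have expand : ∀ v ∈ V, coneWeight U μ A g ξ v = ∑ J : Finset (Fin d),
      if J ⊆ tight U μ v ∧ ∀ i ∈ tight U μ v \ J, 0 < ξ ⬝ᵥ A v i then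
        (∏ i ∈ J, g i) * (-1) ^ (n - J.card) else 0 := by
    intro v hv
    have h1 : coneWeight U μ A g ξ v =
        ∏ i ∈ tight U μ v, (g i + if 0 < ξ ⬝ᵥ A v i then -1 else 0) :=
      Finset.prod_congr rfl fun i _ => by split_ifs <;> ring
    have h2 : (tight U μ v).powerset = Finset.univ.filter fun J => J ⊆ tight U μ v := by
      ext J; simp
    rw [h1, Finset.prod_add, h2, Finset.sum_filter]
    refine Finset.sum_congr rfl fun J _ => ?_
    by_cases hJ : J ⊆ tight U μ v
    · rw [if_pos hJ, Finset.prod_ite_zero, Finset.prod_const, Finset.card_sdiff_of_subset hJ,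
        h.card_tight v hv]
      simp only [hJ, true_and, mul_ite, mul_zero]
    · rw [if_neg hJ, if_neg fun hh => hJ hh.1]
  rw [Finset.sum_congr rfl expand, Finset.sum_comm]
  refine Finset.sum_congr rfl fun J _ => ?_
  split_ifs with hJ
  · obtain ⟨y, hy, hyJ⟩ := hJ
    obtain ⟨v, hv, hJv, hpos⟩ := h.exists_pos_on_edges hξ J (h.mem_body hy) hyJ
    rw [Finset.sum_eq_single_of_mem v hv, if_pos ⟨hJv, hpos⟩]
    intro w hw hwv
    exact if_neg fun hh => hwv (h.eq_of_pos_on_edges hv hw hJv hh.1 hpos hh.2)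
  · exact Finset.sum_eq_zero fun v hv => if_neg fun hh => hJ ⟨v, hv, hh.1⟩

/-- A point in the (weighted) polarized cone at `v` has `ξ`-value at most that of `v`. -/
lemma dotProduct_le_of_coneWeight_ne_zero (h : IsSimple U μ V A) (hv : v ∈ V) (q : ℂ)
    {x : Fin n → ℝ}
    (hne : coneWeight U μ A (fun i => halfLineWeight q (U i ⬝ᵥ x + μ i)) ξ v ≠ 0) :
    ξ ⬝ᵥ x ≤ ξ ⬝ᵥ v := by
  rw [← sub_nonpos, h.dotProduct_sub_eq_sum hv]
  refine Finset.sum_nonpos fun i hi => ?_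
  have hi' := Finset.prod_ne_zero_iff.1 hne i hi
  simp only [halfLineWeight] at hi'
  split_ifs at hi' with h1 h2 h3 h2 h3
  · exact absurd (sub_self _) hi'
  · rw [h3, zero_mul]
  · exact mul_nonpos_of_nonpos_of_nonneg (not_lt.1 h2) h1.le
  · exact mul_nonpos_of_nonneg_of_nonpos h2.le (not_lt.1 h1)
  · rw [h3, zero_mul]
  · exact absurd rfl hi'

lemma eventually_isPolarizing (hξ : IsPolarizing U μ V A ξ) (ξ₀ : Fin n → ℝ) :
    ∀ᶠ ε : ℝ in nhdsWithin 0 (Set.Ioi 0), IsPolarizing U μ V A (ξ₀ + ε • ξ) := by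
  simp only [IsPolarizing]
  refine (Filter.eventually_all_finset V).2 fun v hv =>
    (Filter.eventually_all_finset _).2 fun i hi => ?_
  by_cases h0 : ξ₀ ⬝ᵥ A v i = 0
  · filter_upwards [self_mem_nhdsWithin] with ε hε
    have hε' : (0 : ℝ) < ε := hε
    rw [add_dotProduct, smul_dotProduct, h0, zero_add, smul_eq_mul]
    exact mul_ne_zero hε'.ne' (hξ v hv i hi)
  · have hc : Continuous fun ε : ℝ => (ξ₀ + ε • ξ) ⬝ᵥ A v i := by fun_prop
    have hc0 := hc.tendsto 0
    simp only [zero_smul, add_zero] at hc0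
    exact nhdsWithin_le_nhds (hc0.eventually_ne h0)

lemma eventually_dotProduct_lt (ξ₀ ξ : Fin n → ℝ) {a b : Fin n → ℝ} (hab : ξ₀ ⬝ᵥ a < ξ₀ ⬝ᵥ b) :
    ∀ᶠ ε : ℝ in nhdsWithin 0 (Set.Ioi 0), (ξ₀ + ε • ξ) ⬝ᵥ a < (ξ₀ + ε • ξ) ⬝ᵥ b := by
  have hc : ∀ c : Fin n → ℝ,
      Filter.Tendsto (fun ε : ℝ => (ξ₀ + ε • ξ) ⬝ᵥ c) (nhds 0) (nhds (ξ₀ ⬝ᵥ c)) := by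
    intro c
    have hc : Continuous fun ε : ℝ => (ξ₀ + ε • ξ) ⬝ᵥ c := by fun_prop
    simpa using hc.tendsto 0
  exact nhdsWithin_le_nhds ((hc a).eventually_lt (hc b) hab)

lemma sum_coneWeight_eq_zero (h : IsSimple U μ V A) (hξ : IsPolarizing U μ V A ξ) (q : ℂ)
    {x : Fin n → ℝ} (hx : x ∉ body U μ) :
    ∑ v ∈ V, coneWeight U μ A (fun i => halfLineWeight q (U i ⬝ᵥ x + μ i)) ξ v = 0 := by
  obtain ⟨i, hi⟩ : ∃ i, U i ⬝ᵥ x + μ i < 0 := by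
    simpa [body] using hx
  have hsep : ∀ᶠ ε : ℝ in nhdsWithin 0 (Set.Ioi 0),
      ∀ v ∈ V, (-U i + ε • ξ) ⬝ᵥ v < (-U i + ε • ξ) ⬝ᵥ x :=
    (Filter.eventually_all_finset V).2 fun v hv => eventually_dotProduct_lt _ _ (by
      have := h.mem_body hv i
      simp only [neg_dotProduct]
      linarith)
  obtain ⟨ε, hε, hpol⟩ := (hsep.and (eventually_isPolarizing hξ (-U i))).exists
  rw [h.sum_coneWeight_eq_sum_faces hξ, ← h.sum_coneWeight_eq_sum_faces hpol]
  refine Finset.sum_eq_zero fun v hv => ?_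
  by_contra hne
  exact (hε v hv).not_ge (h.dotProduct_le_of_coneWeight_ne_zero hv q hne)

lemma sum_coneWeight_eq_pow (h : IsSimple U μ V A) (hξ : IsPolarizing U μ V A ξ) (q : ℂ)
    {x : Fin n → ℝ} (hx : x ∈ body U μ) :
    ∑ v ∈ V, coneWeight U μ A (fun i => halfLineWeight q (U i ⬝ᵥ x + μ i)) ξ v =
      q ^ (tight U μ x).card := by
  set ξ₀ : Fin n → ℝ := -∑ i ∈ tight U μ x, U i with hξ₀
  have hsep : ∀ᶠ ε : ℝ in nhdsWithin 0 (Set.Ioi 0),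
      ∀ v ∈ V, ¬ tight U μ x ⊆ tight U μ v → (ξ₀ + ε • ξ) ⬝ᵥ v < (ξ₀ + ε • ξ) ⬝ᵥ x := by
    refine (Filter.eventually_all_finset V).2 fun v hv => ?_
    by_cases hsub : tight U μ x ⊆ tight U μ v
    · simp [hsub]
    obtain ⟨k, hkx, hkv⟩ := Finset.not_subset.1 hsub
    refine (eventually_dotProduct_lt ξ₀ ξ ?_).mono fun ε hε _ => hε
    rw [hξ₀, neg_dotProduct, neg_dotProduct, neg_lt_neg_iff, sum_dotProduct, sum_dotProduct]
    have hle : ∀ i ∈ tight U μ x, U i ⬝ᵥ x ≤ U i ⬝ᵥ v := fun i hi => by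
      have h1 := mem_tight.1 hi
      have h2 := h.mem_body hv i
      linarith
    refine Finset.sum_lt_sum hle ⟨k, hkx, lt_of_le_of_ne (hle k hkx) fun e => hkv ?_⟩
    rw [mem_tight, ← e]
    exact mem_tight.1 hkx
  have hedge : ∀ᶠ ε : ℝ in nhdsWithin 0 (Set.Ioi 0), ∀ v ∈ V, tight U μ x ⊆ tight U μ v →
      ∀ i ∈ tight U μ x, (ξ₀ + ε • ξ) ⬝ᵥ A v i < 0 := by
    refine (Filter.eventually_all_finset V).2 fun v hv => ?_
    by_cases hsub : tight U μ x ⊆ tight U μ v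
    · have : ∀ i ∈ tight U μ x, ∀ᶠ ε : ℝ in nhdsWithin 0 (Set.Ioi 0),
          (ξ₀ + ε • ξ) ⬝ᵥ A v i < 0 := fun i hi => by
        have h1 : ξ₀ ⬝ᵥ A v i = -1 := by
          rw [hξ₀, neg_dotProduct, sum_dotProduct, Finset.sum_eq_single_of_mem i hi,
            h.dual v hv i (hsub hi) i (hsub hi), if_pos rfl]
          intro k hk hki
          rw [h.dual v hv i (hsub hi) k (hsub hk), if_neg hki]
        have h2 := eventually_dotProduct_lt ξ₀ ξ (a := A v i) (b := 0) (by
          rw [h1, dotProduct_zero]; norm_num)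
        simpa only [dotProduct_zero] using h2
      exact ((Filter.eventually_all_finset _).2 this).mono fun ε hε _ => hε
    · simp [hsub]
  obtain ⟨ε, ⟨hε, hedgeε⟩, hpol⟩ := ((hsep.and hedge).and (eventually_isPolarizing hξ ξ₀)).exists
  set η := ξ₀ + ε • ξ with hη
  rw [h.sum_coneWeight_eq_sum_faces hξ, ← h.sum_coneWeight_eq_sum_faces hpol]
  have hpol' : IsPolarizing U μ V A (-η) := fun v hv i hi => by
    rw [neg_dotProduct]
    exact neg_ne_zero.2 (hpol v hv i hi)
  obtain ⟨v, hv, -, hpos⟩ :=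
    h.exists_pos_on_edges hpol' ∅ hx (Finset.empty_subset _)
  have hneg : ∀ i ∈ tight U μ v, η ⬝ᵥ A v i < 0 := fun i hi => by
    have := hpos i (by simpa using hi)
    rw [neg_dotProduct] at this
    linarith
  have hvx : tight U μ x ⊆ tight U μ v := by
    by_contra hsub
    have h1 := hε v hv hsub
    have h2 := h.dotProduct_sub_eq_sum hv η x
    have h3 := Finset.sum_nonpos fun i hi =>
      mul_nonpos_of_nonneg_of_nonpos (hx i) (hneg i hi).le
    linarith
  rw [Finset.sum_eq_single_of_mem v hv]
  · have hval : ∀ i ∈ tight U μ v,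
        (if 0 < η ⬝ᵥ A v i then halfLineWeight q (U i ⬝ᵥ x + μ i) - 1
          else halfLineWeight q (U i ⬝ᵥ x + μ i)) = if i ∈ tight U μ x then q else 1 := by
      intro i hi
      rw [if_neg (hneg i hi).not_gt, halfLineWeight]
      by_cases hix : i ∈ tight U μ x
      · simp [hix, mem_tight.1 hix]
      · have : 0 < U i ⬝ᵥ x + μ i :=
          lt_of_le_of_ne (hx i) fun e => hix (mem_tight.2 e.symm)
        simp [hix, this]
    rw [coneWeight, Finset.prod_congr rfl hval, Finset.prod_ite_mem,
      Finset.inter_eq_right.2 hvx, Finset.prod_const]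
  · intro w hw hwv
    by_contra hne
    have hwx : tight U μ x ⊆ tight U μ w := by
      by_contra hsub
      exact (hε w hw hsub).not_ge (h.dotProduct_le_of_coneWeight_ne_zero hw q hne)
    refine hwv (h.eq_of_pos_on_edges (ξ := -η) hv hw (Finset.empty_subset _)
      (Finset.empty_subset _) hpos fun i hi => ?_)
    have hiw : i ∈ tight U μ w := (Finset.mem_sdiff.1 hi).1
    rw [neg_dotProduct, neg_pos]
    by_cases hix : i ∈ tight U μ x
    · exact hedgeε w hw hwx i hix
    · have hxi : 0 < U i ⬝ᵥ x + μ i :=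
        lt_of_le_of_ne (hx i) fun e => hix (mem_tight.2 e.symm)
      have hi' := Finset.prod_ne_zero_iff.1 hne i hiw
      refine lt_of_le_of_ne (not_lt.1 fun hpos' => hi' ?_) (hpol w hw i hiw)
      simp [halfLineWeight, hpos', hxi]

end IsSimple

/-- The signed weighted indicator of the polarized tangent cone in closed form. -/
lemma coneWeight_halfLineWeight (q : ℂ) (x : Fin n → ℝ) :
    coneWeight U μ A (fun i => halfLineWeight q (U i ⬝ᵥ x + μ i)) ξ v =
      (-1 : ℂ) ^ (Finset.univ.filter fun i =>
          U i ⬝ᵥ v + μ i = 0 ∧ 0 < ξ ⬝ᵥ A v i).card *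
        (if ∀ i, U i ⬝ᵥ v + μ i = 0 →
            0 ≤ (if 0 < ξ ⬝ᵥ A v i then -(U i ⬝ᵥ x + μ i) else U i ⬝ᵥ x + μ i) then
          ∏ i ∈ Finset.univ.filter (fun i => U i ⬝ᵥ v + μ i = 0 ∧ U i ⬝ᵥ x + μ i = 0),
            (if 0 < ξ ⬝ᵥ A v i then 1 - q else q)
        else 0) := by
  split_ifs with hx
  · rw [← Finset.prod_const, ← Finset.filter_filter, ← Finset.filter_filter,
      Finset.prod_filter (fun i => 0 < ξ ⬝ᵥ A v i),
      Finset.prod_filter (fun i => U i ⬝ᵥ x + μ i = 0), ← Finset.prod_mul_distrib, coneWeight,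
      tight]
    refine Finset.prod_congr rfl fun i hi => ?_
    have hxi := hx i (mem_tight.1 hi)
    rw [halfLineWeight]
    rcases lt_trichotomy (U i ⬝ᵥ x + μ i) 0 with h1 | h1 | h1 <;>
      by_cases h2 : 0 < ξ ⬝ᵥ A v i
    · simp [h2, h1.ne, h1.not_gt]
    · rw [if_neg h2] at hxi
      exact absurd hxi h1.not_ge
    · simp [h2, h1]
    · simp [h2, h1]
    · rw [if_pos h2] at hxi
      linarith
    · simp [h2, h1, h1.ne']
  · push Not at hx
    obtain ⟨i, hi, hxi⟩ := hx
    rw [mul_zero]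
    refine Finset.prod_eq_zero (mem_tight.2 hi) ?_
    split_ifs at hxi ⊢ with h2
    · simp [halfLineWeight, neg_lt_zero.1 hxi]
    · simp [halfLineWeight, hxi.not_gt, hxi.ne]

/-- Pointwise form of the weighted polar decomposition. -/
lemma IsSimple.weighted_indicator_eq (h : IsSimple U μ V A) (hξ : IsPolarizing U μ V A ξ)
    (q : ℂ) (x : Fin n → ℝ) :
    (if ∀ i, 0 ≤ U i ⬝ᵥ x + μ i then q ^ (tight U μ x).card else 0) =
      ∑ v ∈ V, coneWeight U μ A (fun i => halfLineWeight q (U i ⬝ᵥ x + μ i)) ξ v := by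
  split_ifs with hx
  · exact (h.sum_coneWeight_eq_pow hξ q hx).symm
  · exact (h.sum_coneWeight_eq_zero hξ q hx).symm

end SimplePolytope

/-- A compactly supported function is nonzero at finitely many lattice points. -/
lemma HasCompactSupport.finite_support_lattice {n : ℕ} {f : (Fin n → ℝ) → ℂ}
    (hf : HasCompactSupport f) :
    {x : Fin n → ℤ | f (fun j => (x j : ℝ)) ≠ 0}.Finite := by
  have hemb : Topology.IsClosedEmbedding fun (x : Fin n → ℤ) j => (x j : ℝ) :=
    Topology.IsClosedEmbedding.piMap fun _ => Int.isClosedEmbedding_coe_real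
  exact (hemb.isCompact_preimage hf.isCompact).finite_of_discrete.subset
    fun x hx => subset_tsupport f hx

/-- **Weighted polar decomposition of a simple integral polytope.**
Let `Δ = ∩ᵢ {x : ⟨uᵢ,x⟩ + μᵢ ≥ 0} ⊂ ℝⁿ` be a simple integral polytope (compact, with
nonempty interior, primitive normals `uᵢ`, facets of affine dimension `n-1`, vertex set
`V ⊂ ℤⁿ`, each vertex on exactly `n` facet hyperplanes with independent normals).  For
each vertex `v`, `A v i` (for `i ∈ I_v`) are the edge vectors, dual to `{uᵢ}_{i∈I_v}`,
and `ξ` is a polarizing vector.  Then for `q ∈ ℂ` and any compactly supported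
`f : ℝⁿ → ℂ`,
`∑_{x∈Δ∩ℤⁿ} q^{c(x)} f(x) = ∑_v (-1)^{#v} ∑_{x∈C_v^♯∩ℤⁿ} w_v^♯(x) f(x)`. -/
theorem weighted_polar_decomposition
    (n d : ℕ) (u : Fin d → Fin n → ℤ) (μ : Fin d → ℝ) (q : ℂ)
    (hcomp : IsCompact {x : Fin n → ℝ | ∀ i, 0 ≤ intPair (u i) x + μ i})
    (hint : (interior {x : Fin n → ℝ | ∀ i, 0 ≤ intPair (u i) x + μ i}).Nonempty)
    (hprim : ∀ i, ¬∃ m : ℤ, 1 < m ∧ ∃ w : Fin n → ℤ, ∀ j, u i j = m * w j)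
    (hfacet : ∀ i, Module.finrank ℝ
      (affineSpan ℝ ({x : Fin n → ℝ | ∀ i', 0 ≤ intPair (u i') x + μ i'} ∩
        {x : Fin n → ℝ | intPair (u i) x + μ i = 0})).direction = n - 1)
    (V : Finset (Fin n → ℝ))
    (hV : (V : Set (Fin n → ℝ)) =
      Set.extremePoints ℝ {x : Fin n → ℝ | ∀ i, 0 ≤ intPair (u i) x + μ i})
    (hVint : ∀ v ∈ V, ∃ g : Fin n → ℤ, v = fun j => (g j : ℝ))
    (hsimple : ∀ v ∈ V,
      (Finset.univ.filter fun i => intPair (u i) v + μ i = 0).card = n ∧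
      LinearIndependent ℝ (fun i : {i : Fin d // intPair (u i) v + μ i = 0} =>
        fun j => (u i.1 j : ℝ)))
    (A : (Fin n → ℝ) → Fin d → (Fin n → ℝ))
    (hA : ∀ v ∈ V, ∀ i, intPair (u i) v + μ i = 0 →
      ∀ i', intPair (u i') v + μ i' = 0 →
        (∑ l, (u i' l : ℝ) * A v i l) = if i' = i then 1 else 0)
    (ξ : Fin n → ℝ)
    (hξ : ∀ v ∈ V, ∀ i, intPair (u i) v + μ i = 0 → (∑ l, ξ l * A v i l) ≠ 0)
    (f : (Fin n → ℝ) → ℂ) (hf : HasCompactSupport f) :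
    (∑' x : Fin n → ℤ,
      (if ∀ i, 0 ≤ intPair (u i) (fun j => (x j : ℝ)) + μ i then
        q ^ (Finset.univ.filter fun i =>
          intPair (u i) (fun j => (x j : ℝ)) + μ i = 0).card
      else 0) * f (fun j => (x j : ℝ))) =
    ∑ v ∈ V,
      (-1 : ℂ) ^ (Finset.univ.filter fun i =>
          intPair (u i) v + μ i = 0 ∧ 0 < ∑ l, ξ l * A v i l).card *
      ∑' x : Fin n → ℤ,
        (if ∀ i, intPair (u i) v + μ i = 0 →
            0 ≤ (if 0 < ∑ l, ξ l * A v i l then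
              -(intPair (u i) (fun j => (x j : ℝ)) + μ i)
            else intPair (u i) (fun j => (x j : ℝ)) + μ i) then
          ∏ i ∈ Finset.univ.filter (fun i => intPair (u i) v + μ i = 0 ∧
              intPair (u i) (fun j => (x j : ℝ)) + μ i = 0),
            (if 0 < ∑ l, ξ l * A v i l then 1 - q else q)
        else 0) * f (fun j => (x j : ℝ)) := by
  have hS : SimplePolytope.IsSimple (fun i j => (u i j : ℝ)) μ V A :=
    { isCompact := hcomp
      coe_vertices := hV
      card_tight := fun v hv => (hsimple v hv).1
      linearIndependent := fun v hv => (hsimple v hv).2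
      dual := fun v hv i hi i' hi' =>
        hA v hv i (SimplePolytope.mem_tight.1 hi) i' (SimplePolytope.mem_tight.1 hi') }
  have hP : SimplePolytope.IsPolarizing (fun i j => (u i j : ℝ)) μ V A ξ :=
    fun v hv i hi => hξ v hv i (SimplePolytope.mem_tight.1 hi)
  have hsum : ∀ c : (Fin n → ℤ) → ℂ, Summable fun x => c x * f (fun j => (x j : ℝ)) :=
    fun c => summable_of_hasFiniteSupport (hf.finite_support_lattice.subset
      fun x hx => right_ne_zero_of_mul hx)
  simp_rw [← tsum_mul_left, ← mul_assoc]
  rw [← Summable.tsum_finsetSum fun v _ => hsum _]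
  refine tsum_congr fun x => ?_
  rw [← Finset.sum_mul]
  congr 1
  refine (hS.weighted_indicator_eq hP q _).trans (Finset.sum_congr rfl fun v _ => ?_)
  exact SimplePolytope.coneWeight_halfLineWeight q _
end
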